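/- arXiv:2008.10315 — 4 statements merged into one kernel-verified Lean document; each statement's English description precedes it below -/
import Mathlib

section
/- Let k ≥ 1 and d ≥ k+1. Then for every n ≥ 2 and every base-point-free linear subspace U ⊆ A(n)_d of codimension k, one has codim U² ≤ m(3k, k, k); in particular this bound depends only on k and not on n or d. -/
open MvPolynomial Module

noncomputable section

abbrev PolyR (n : ℕ) := MvPolynomial (Fin n) ℂ

def formSpace (n d : ℕ) : Submodule ℂ (PolyR n) :=
  homogeneousSubmodule (Fin n) ℂ d

/-- Codimension of a subspace `U` inside the space of degree-`d` forms. -/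
def vcodim (n d : ℕ) (U : Submodule ℂ (PolyR n)) : ℕ :=
  finrank ℂ (formSpace n d) - finrank ℂ U

/-- `U` is base-point-free: the only common zero of its members in `ℂⁿ` is `0`. -/
def IsBPF (n : ℕ) (U : Submodule ℂ (PolyR n)) : Prop :=
  ∀ x : Fin n → ℂ, (∀ p ∈ U, eval x p = 0) → x = 0

/-- `m(n,d,k)`: maximum of `codim U²` over codimension-`k` subspaces `U ⊆ A(n)_d`. -/
def mMax (n d k : ℕ) : ℕ :=
  sSup { s | ∃ U : Submodule ℂ (PolyR n),
    U ≤ formSpace n d ∧ vcodim n d U = k ∧ vcodim n (2 * d) (U * U) = s }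

def linForm (n : ℕ) (c : Fin n → ℂ) : PolyR n := ∑ i, c i • X i

def colon (n d : ℕ) (U : Submodule ℂ (PolyR n)) (l : PolyR n) : Submodule ℂ (PolyR n) :=
  Submodule.comap (LinearMap.mulLeft ℂ l) U ⊓ formSpace n (d - 1)

end


instance fs_fd (n d : ℕ) : FiniteDimensional ℂ (formSpace n d) := by
  have := homogeneousSubmodule_fg (σ := Fin n) (R := ℂ) d
  exact Module.Finite.iff_fg.mpr this

theorem fd_of_le {n d : ℕ} {U : Submodule ℂ (PolyR n)} (h : U ≤ formSpace n d) :
    FiniteDimensional ℂ U := Submodule.finiteDimensional_of_le h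

theorem fs_pow (n d : ℕ) : formSpace n 1 ^ d = formSpace n d :=
  homogeneousSubmodule_one_pow ..

theorem fs_mul (n a b : ℕ) : formSpace n a * formSpace n b = formSpace n (a + b) := by
  rw [← fs_pow n a, ← fs_pow n b, ← pow_add, fs_pow]

theorem mul_mem_fs {n a b : ℕ} {p q : PolyR n} (hp : p ∈ formSpace n a) (hq : q ∈ formSpace n b) :
    p * q ∈ formSpace n (a + b) := by
  rw [← fs_mul]; exact Submodule.mul_mem_mul hp hq

theorem pow_mem_fs {n a : ℕ} {p : PolyR n} (hp : p ∈ formSpace n 1) :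
    p ^ a ∈ formSpace n a := by
  rw [← fs_pow]; exact Submodule.pow_mem_pow _ hp a

theorem X_mem_fs {n : ℕ} (i : Fin n) : (X i : PolyR n) ∈ formSpace n 1 :=
  isHomogeneous_X _ _

theorem vcodim_eq {n d : ℕ} {U : Submodule ℂ (PolyR n)} (h : U ≤ formSpace n d) :
    vcodim n d U = finrank ℂ (formSpace n d ⧸ U.submoduleOf (formSpace n d)) := by
  unfold vcodim
  have h1 := Submodule.finrank_quotient_add_finrank (U.submoduleOf (formSpace n d))
  have h2 := (Submodule.submoduleOfEquivOfLe h).finrank_eq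
  omega

/-- Codimension comparison along a map that is surjective modulo `Y`. -/
theorem lemC {N n e e' : ℕ} {X : Submodule ℂ (PolyR N)} {Y : Submodule ℂ (PolyR n)}
    (hX : X ≤ formSpace N e) (hY : Y ≤ formSpace n e') (f : PolyR N →ₗ[ℂ] PolyR n)
    (hf : (formSpace N e).map f ≤ formSpace n e')
    (hsurj : formSpace n e' ≤ Y ⊔ (formSpace N e).map f) (hXY : X.map f ≤ Y) :
    vcodim n e' Y ≤ vcodim N e X := by
  rw [vcodim_eq hX, vcodim_eq hY]
  let g : formSpace N e →ₗ[ℂ] formSpace n e' := f.restrict (fun x hx => hf ⟨x, hx, rfl⟩)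
  have hg : X.submoduleOf (formSpace N e) ≤ (Y.submoduleOf (formSpace n e')).comap g := by
    intro x hx
    exact hXY ⟨x, hx, rfl⟩
  refine LinearMap.finrank_le_finrank_of_surjective (f := Submodule.mapQ _ _ g hg) ?_
  intro q
  obtain ⟨y, rfl⟩ := Submodule.mkQ_surjective _ q
  obtain ⟨a, ha, b, ⟨c, hc, rfl⟩, hab⟩ := Submodule.mem_sup.mp (hsurj y.2)
  refine ⟨Submodule.mkQ _ ⟨c, hc⟩, ?_⟩
  simp only [Submodule.mkQ_apply, Submodule.mapQ_apply]
  rw [Submodule.Quotient.eq]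
  change (f c - (y : PolyR n)) ∈ Y
  rw [← hab]
  simpa using ha

theorem lemC' {N n e e' : ℕ} {X : Submodule ℂ (PolyR N)} {Y : Submodule ℂ (PolyR n)}
    (hX : X ≤ formSpace N e) (hY : Y ≤ formSpace n e') (f : PolyR N →ₗ[ℂ] PolyR n)
    (hf : (formSpace N e).map f ≤ formSpace n e')
    (hXY : ∀ p ∈ formSpace N e, f p ∈ Y → p ∈ X) (hXY' : X.map f ≤ Y) :
    vcodim N e X ≤ vcodim n e' Y := by
  rw [vcodim_eq hX, vcodim_eq hY]
  let g : formSpace N e →ₗ[ℂ] formSpace n e' := f.restrict (fun x hx => hf ⟨x, hx, rfl⟩)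
  have hg : X.submoduleOf (formSpace N e) ≤ (Y.submoduleOf (formSpace n e')).comap g := by
    intro x hx
    exact hXY' ⟨x, hx, rfl⟩
  refine LinearMap.finrank_le_finrank_of_injective (f := Submodule.mapQ _ _ g hg) ?_
  rw [injective_iff_map_eq_zero]
  intro q
  obtain ⟨y, rfl⟩ := Submodule.mkQ_surjective _ q
  simp only [Submodule.mkQ_apply, Submodule.mapQ_apply, Submodule.Quotient.mk_eq_zero]
  intro h
  exact hXY y y.2 h

theorem lemPhi {n d k : ℕ} {U : Submodule ℂ (PolyR n)} (hU : U ≤ formSpace n d)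
    (hc : vcodim n d U = k) : ∃ Φ : PolyR n →ₗ[ℂ] (Fin k → ℂ),
      (∀ p ∈ formSpace n d, Φ p = 0 ↔ p ∈ U) ∧ (formSpace n d).map Φ = ⊤ := by
  rw [vcodim_eq hU] at hc
  let e : (formSpace n d ⧸ U.submoduleOf (formSpace n d)) ≃ₗ[ℂ] (Fin k → ℂ) :=
    LinearEquiv.ofFinrankEq _ _ (by simp [hc])
  obtain ⟨Φ, hΦ⟩ := LinearMap.exists_extend (e.toLinearMap ∘ₗ Submodule.mkQ _)
  have h (p) (hp : p ∈ formSpace n d) : Φ p = e (Submodule.mkQ _ ⟨p, hp⟩) :=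
    LinearMap.congr_fun hΦ ⟨p, hp⟩
  refine ⟨Φ, ?_, ?_⟩
  · intro p hp
    rw [h p hp]
    rw [e.map_eq_zero_iff, Submodule.mkQ_apply, Submodule.Quotient.mk_eq_zero]
    rfl
  · rw [eq_top_iff]
    intro v _
    obtain ⟨y, hy⟩ := Submodule.mkQ_surjective _ (e.symm v)
    refine ⟨y, y.2, ?_⟩
    rw [h y y.2, hy]; simp

theorem evLI {r k : ℕ} (w : ℂ → Fin r → (Fin k → ℂ)) (hc : ∀ i, Continuous (fun t => w t i))
    (h0 : LinearIndependent ℂ (w 0)) (S : ℂ → Submodule ℂ (Fin k → ℂ))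
    (hS : ∀ t, t ≠ 0 → ∀ i, w t i ∈ S t) :
    ∀ᶠ t in nhdsWithin (0 : ℂ) {0}ᶜ, r ≤ finrank ℂ (S t) := by
  have hcont : Continuous w := continuous_pi hc
  have h1 : ∀ᶠ t in nhds (0 : ℂ), LinearIndependent ℂ (w t) :=
    hcont.continuousAt.eventually h0.eventually
  filter_upwards [nhdsWithin_le_nhds h1, self_mem_nhdsWithin] with t ht htne
  have h2 := finrank_span_eq_card ht
  rw [Fintype.card_fin] at h2
  rw [← h2]
  apply Submodule.finrank_mono
  rw [Submodule.span_le]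
  rintro _ ⟨i, rfl⟩
  exact hS t htne i

theorem contPhi {n k : ℕ} (Φ : PolyR n →ₗ[ℂ] (Fin k → ℂ)) (l v : PolyR n) (i : ℕ) (c : PolyR n) :
    Continuous (fun t : ℂ => Φ ((l + t • v) ^ i * c)) := by
  induction i generalizing c with
  | zero => simpa using continuous_const
  | succ i ih =>
    have : (fun t : ℂ => Φ ((l + t • v) ^ (i + 1) * c)) =
        fun t : ℂ => Φ ((l + t • v) ^ i * (l * c)) + t • Φ ((l + t • v) ^ i * (v * c)) := by
      funext t
      rw [← map_smul, ← map_add]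
      congr 1
      rw [smul_eq_C_mul, smul_eq_C_mul]
      ring
    rw [this]
    exact (ih _).add (continuous_id.smul (ih _))

noncomputable def IG {n k : ℕ} (Φ : PolyR n →ₗ[ℂ] (Fin k → ℂ)) (d : ℕ) (l : PolyR n) (j : ℕ) :
    Submodule ℂ (Fin k → ℂ) :=
  (formSpace n (d - j)).map (Φ ∘ₗ LinearMap.mulLeft ℂ (l ^ j))

theorem mem_IG {n k : ℕ} {Φ : PolyR n →ₗ[ℂ] (Fin k → ℂ)} {d : ℕ} {l : PolyR n} {j : ℕ}
    {x : Fin k → ℂ} : x ∈ IG Φ d l j ↔ ∃ b ∈ formSpace n (d - j), Φ (l ^ j * b) = x := Iff.rfl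

theorem IG_basis {n k : ℕ} (Φ : PolyR n →ₗ[ℂ] (Fin k → ℂ)) (d : ℕ) (l : PolyR n) (j : ℕ) :
    ∃ c : Fin (finrank ℂ (IG Φ d l j)) → PolyR n, (∀ i, c i ∈ formSpace n (d - j)) ∧
      LinearIndependent ℂ (fun i => Φ (l ^ j * c i)) ∧
      Submodule.span ℂ (Set.range (fun i => Φ (l ^ j * c i))) = IG Φ d l j := by
  let b := finBasis ℂ (IG Φ d l j)
  have h : ∀ i, ∃ c ∈ formSpace n (d - j), Φ (l ^ j * c) = b i := fun i => mem_IG.mp (b i).2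
  choose c hc hcb using h
  have hE : (fun i => Φ (l ^ j * c i)) = (IG Φ d l j).subtype ∘ b := by
    funext i; simp [hcb]
  refine ⟨c, hc, ?_, ?_⟩
  · rw [hE]
    exact b.linearIndependent.map' _ (Submodule.ker_subtype _)
  · rw [hE, Set.range_comp, ← Submodule.map_span, b.span_eq]
    simp

theorem IG_lsc {n k : ℕ} (Φ : PolyR n →ₗ[ℂ] (Fin k → ℂ)) (d : ℕ) (l v : PolyR n) (j : ℕ) :
    ∀ᶠ t in nhdsWithin (0 : ℂ) {0}ᶜ, finrank ℂ (IG Φ d l j) ≤ finrank ℂ (IG Φ d (l + t • v) j) := by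
  obtain ⟨c, hc, hli, -⟩ := IG_basis Φ d l j
  refine evLI (fun t i => Φ ((l + t • v) ^ j * c i)) (fun i => contPhi ..) (by simpa using hli) _ ?_
  intro t _ i
  exact mem_IG.mpr ⟨c i, hc i, rfl⟩

theorem IG_tangent {n k : ℕ} (Φ : PolyR n →ₗ[ℂ] (Fin k → ℂ)) (d : ℕ) (l : PolyR n)
    (hl : l ∈ formSpace n 1)
    (hmax : ∀ m ∈ formSpace n 1, ∑ i ∈ Finset.range (d + 1), finrank ℂ (IG Φ d m i) ≤
      ∑ i ∈ Finset.range (d + 1), finrank ℂ (IG Φ d l i))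
    (j : ℕ) (hj : j + 1 ≤ d) (b : PolyR n) (hb : b ∈ formSpace n (d - (j + 1)))
    (hb0 : Φ (l ^ (j + 1) * b) = 0) (v : PolyR n) (hv : v ∈ formSpace n 1) :
    Φ (l ^ j * (v * b)) ∈ IG Φ d l (j + 1) := by
  by_contra hcon
  obtain ⟨c, hc, hli, hspan⟩ := IG_basis Φ d l (j + 1)
  let q : ℂ → PolyR n := fun t => ∑ i ∈ Finset.range (j + 1), (l + t • v) ^ i * l ^ (j - i)
  have hq : ∀ t, t • (q t * (v * b)) = (l + t • v) ^ (j + 1) * b - l ^ (j + 1) * b := by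
    intro t
    have := (Commute.all (l + t • v) l).geom_sum₂_mul (j + 1)
    simp only [add_tsub_cancel_right, add_sub_cancel_left] at this
    rw [← sub_mul, ← this]
    rw [smul_eq_C_mul, smul_eq_C_mul]
    simp only [q, smul_eq_C_mul]
    ring
  have hq0 : Φ (q 0 * (v * b)) = ((j : ℂ) + 1) • Φ (l ^ j * (v * b)) := by
    rw [← map_smul]
    congr 1
    have : q 0 = ((j : ℂ) + 1) • l ^ j := by
      simp only [q, zero_smul, add_zero]
      rw [Finset.sum_congr rfl (g := fun _ => l ^ j)]
      · simp [smul_eq_C_mul]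
      · intro i hi
        rw [← pow_add]
        congr 1
        have := Finset.mem_range.mp hi
        omega
    rw [this, smul_mul_assoc]
  have hj0 : ((j : ℂ) + 1) ≠ 0 := by exact_mod_cast Nat.succ_ne_zero j
  have hev : ∀ᶠ t in nhdsWithin (0 : ℂ) {0}ᶜ, 
      finrank ℂ (IG Φ d l (j + 1)) + 1 ≤ finrank ℂ (IG Φ d (l + t • v) (j + 1)) := by
    refine evLI (fun t => Fin.cons (Φ (q t * (v * b))) (fun i => Φ ((l + t • v) ^ (j + 1) * c i)))
      ?_ ?_ _ ?_
    · intro i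
      refine Fin.cases ?_ (fun i => ?_) i
      · simp only [Fin.cons_zero, q, Finset.sum_mul, map_sum]
        refine continuous_finsetSum _ (fun i _ => ?_)
        simp only [mul_assoc]
        exact contPhi ..
      · simp only [Fin.cons_succ]
        exact contPhi ..
    · rw [linearIndependent_finCons]
      refine ⟨by simpa using hli, ?_⟩
      simp only [zero_smul, add_zero]
      rw [hspan, hq0]
      intro h
      exact hcon ((Submodule.smul_mem_iff _ hj0).mp h)
    · intro t ht i
      refine Fin.cases ?_ (fun i => ?_) i
      · simp only [Fin.cons_zero]
        have h1 := hq t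
        have h2 : t • Φ (q t * (v * b)) = Φ ((l + t • v) ^ (j + 1) * b) := by
          rw [← map_smul, h1, map_sub, hb0, sub_zero]
        refine (Submodule.smul_mem_iff _ ht).mp ?_
        rw [h2]
        exact mem_IG.mpr ⟨b, hb, rfl⟩
      · simp only [Fin.cons_succ]
        exact mem_IG.mpr ⟨c i, hc i, rfl⟩
  have hall : ∀ᶠ t in nhdsWithin (0 : ℂ) {0}ᶜ, ∀ i ∈ Finset.range (d + 1),
      finrank ℂ (IG Φ d l i) ≤ finrank ℂ (IG Φ d (l + t • v) i) := by
    rw [Filter.eventually_all_finset]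
    intro i _
    exact IG_lsc ..
  obtain ⟨t, ht1, ht2⟩ := (hev.and hall).exists
  have h3 := hmax (l + t • v) (Submodule.add_mem _ hl (Submodule.smul_mem _ _ hv))
  have h4 := Finset.sum_lt_sum ht2 ⟨j + 1, Finset.mem_range.mpr (by omega), ht1⟩
  omega

theorem IG_max {n k : ℕ} (Φ : PolyR n →ₗ[ℂ] (Fin k → ℂ)) (d : ℕ) :
    ∃ l ∈ formSpace n 1, ∀ m ∈ formSpace n 1,
      ∑ i ∈ Finset.range (d + 1), finrank ℂ (IG Φ d m i) ≤
      ∑ i ∈ Finset.range (d + 1), finrank ℂ (IG Φ d l i) := by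
  let F : formSpace n 1 → ℕ := fun m => ∑ i ∈ Finset.range (d + 1), finrank ℂ (IG Φ d m i)
  have hbdd : BddAbove (Set.range F) := by
    refine ⟨∑ i ∈ Finset.range (d + 1), k, ?_⟩
    rintro _ ⟨m, rfl⟩
    refine Finset.sum_le_sum (fun i _ => ?_)
    simpa using Submodule.finrank_le (IG Φ d m i)
  obtain ⟨l, hl⟩ := Nat.sSup_mem (Set.range_nonempty F) hbdd
  refine ⟨l, l.2, fun m hm => ?_⟩
  have := le_csSup hbdd ⟨⟨m, hm⟩, rfl⟩
  rw [← hl] at this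
  exact this

theorem IG_anti {n k : ℕ} (Φ : PolyR n →ₗ[ℂ] (Fin k → ℂ)) (d : ℕ) (l : PolyR n)
    (hl : l ∈ formSpace n 1) (j : ℕ) (hj : j + 1 ≤ d) : IG Φ d l (j + 1) ≤ IG Φ d l j := by
  intro x hx
  obtain ⟨b, hb, rfl⟩ := mem_IG.mp hx
  refine mem_IG.mpr ⟨l * b, ?_, by ring_nf⟩
  have := mul_mem_fs hl hb
  rwa [show 1 + (d - (j + 1)) = d - j by omega] at this

/-- Propagation of equalities downwards; `W` is the next term of the chain. -/
theorem IG_step {n k : ℕ} (Φ : PolyR n →ₗ[ℂ] (Fin k → ℂ)) (d : ℕ) (l : PolyR n)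
    (hl : l ∈ formSpace n 1)
    (hmax : ∀ m ∈ formSpace n 1, ∑ i ∈ Finset.range (d + 1), finrank ℂ (IG Φ d m i) ≤
      ∑ i ∈ Finset.range (d + 1), finrank ℂ (IG Φ d l i))
    (j : ℕ) (hj : j + 1 ≤ d)
    (h : (j + 2 ≤ d ∧ IG Φ d l (j + 1) ≤ IG Φ d l (j + 2)) ∨ IG Φ d l (j + 1) = ⊥) :
    IG Φ d l j ≤ IG Φ d l (j + 1) := by
  have key : ∀ b ∈ formSpace n (d - (j + 1)), ∀ v ∈ formSpace n 1,
      Φ (l ^ j * (v * b)) ∈ IG Φ d l (j + 1) := by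
    intro b hb v hv
    have hmem : Φ (l ^ (j + 1) * b) ∈ IG Φ d l (j + 1) := mem_IG.mpr ⟨b, hb, rfl⟩
    rcases h with ⟨hj2, h⟩ | h
    · obtain ⟨c, hc, hcb⟩ := mem_IG.mp (h hmem)
      have hlc : l * c ∈ formSpace n (d - (j + 1)) := by
        have := mul_mem_fs hl hc
        rwa [show 1 + (d - (j + 2)) = d - (j + 1) by omega] at this
      have h1 := IG_tangent Φ d l hl hmax j hj (b - l * c) (Submodule.sub_mem _ hb hlc)
        (by rw [mul_sub, map_sub, ← hcb]; ring_nf) v hv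
      have h2 : Φ (l ^ j * (v * (l * c))) ∈ IG Φ d l (j + 1) := by
        refine mem_IG.mpr ⟨v * c, ?_, by ring_nf⟩
        have := mul_mem_fs hv hc
        rwa [show 1 + (d - (j + 2)) = d - (j + 1) by omega] at this
      have h3 := Submodule.add_mem _ h1 h2
      rw [← map_add] at h3
      convert h3 using 2
      ring
    · rw [h, Submodule.mem_bot] at hmem
      exact IG_tangent Φ d l hl hmax j hj b hb hmem v hv
  intro x hx
  obtain ⟨b, hb, rfl⟩ := mem_IG.mp hx
  rw [show d - j = 1 + (d - (j + 1)) by omega, ← fs_mul] at hb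
  refine Submodule.mul_induction_on hb (fun v hv b hb => key b hb v hv) ?_
  intro x y hx hy
  rw [mul_add, map_add]
  exact Submodule.add_mem _ hx hy

theorem lemG {n k : ℕ} (Φ : PolyR n →ₗ[ℂ] (Fin k → ℂ)) (d j : ℕ) (hjd : j ≤ d)
    (hk : k + j ≤ d + 1) : ∃ l ∈ formSpace n 1, (formSpace n d).map Φ ≤ IG Φ d l j := by
  obtain ⟨l, hl, hmax⟩ := IG_max Φ d
  refine ⟨l, hl, ?_⟩
  -- once strict, drops stay strict
  have hdrop : ∀ a, a + 1 ≤ d → ¬ (IG Φ d l a ≤ IG Φ d l (a + 1)) →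
      ∀ i, a + i ≤ d → d - a - i + 1 ≤ finrank ℂ (IG Φ d l (a + i)) ∧
        (a + i + 1 ≤ d → ¬ (IG Φ d l (a + i) ≤ IG Φ d l (a + i + 1))) := by
    intro a ha hna
    have h1 : ∀ i, a + i + 1 ≤ d → ¬ (IG Φ d l (a + i) ≤ IG Φ d l (a + i + 1)) := by
      intro i
      induction i with
      | zero => intro _; exact hna
      | succ i ih =>
        intro hi hle
        exact ih (by omega) (IG_step Φ d l hl hmax (a + i) (by omega) (Or.inl ⟨hi, hle⟩))
    have h2 : IG Φ d l d ≠ ⊥ := by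
      intro h
      have h3 := h1 (d - 1 - a) (by omega)
      rw [show a + (d - 1 - a) = d - 1 by omega] at h3
      apply h3
      exact IG_step Φ d l hl hmax (d - 1) (by omega)
        (Or.inr (by rwa [show d - 1 + 1 = d by omega]))
    have h4 : ∀ s, s ≤ d - a → s + 1 ≤ finrank ℂ (IG Φ d l (d - s)) := by
      intro s
      induction s with
      | zero =>
        intro _
        have := Submodule.one_le_finrank_iff.mpr h2
        simpa using this
      | succ s ih =>
        intro hs
        have h5 := ih (by omega)
        have h6 := h1 (d - (s + 1) - a) (by omega)
        rw [show a + (d - (s + 1) - a) = d - (s + 1) by omega,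
          show d - (s + 1) + 1 = d - s by omega] at h6
        have h7 := IG_anti Φ d l hl (d - (s + 1)) (by omega)
        rw [show d - (s + 1) + 1 = d - s by omega] at h7
        have h8 := Submodule.finrank_lt_finrank_of_lt (lt_of_le_not_ge h7 h6)
        omega
    intro i hi
    refine ⟨?_, h1 i⟩
    have := h4 (d - a - i) (by omega)
    rwa [show d - (d - a - i) = a + i by omega] at this
  have hle : ∀ a, a ≤ j → IG Φ d l 0 ≤ IG Φ d l a := by
    intro a
    induction a with
    | zero => intro _; exact le_rfl
    | succ a ih =>
      intro haj
      refine (ih (by omega)).trans ?_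
      by_contra hna
      have h1 := (hdrop a (by omega) hna 0 (by omega)).1
      have h2 := Submodule.finrank_le (IG Φ d l (a + 0))
      simp only [finrank_fintype_fun_eq_card, Fintype.card_fin] at h2
      omega
  refine le_trans ?_ (hle j le_rfl)
  rintro _ ⟨b, hb, rfl⟩
  exact mem_IG.mpr ⟨b, by simpa using hb, by simp⟩

theorem lemPow {n d : ℕ} (φ : PolyR n →ₗ[ℂ] ℂ) (h : ∀ m ∈ formSpace n 1, φ (m ^ d) = 0) :
    ∀ p ∈ formSpace n d, φ p = 0 := by
  intro p hp
  obtain ⟨l, hl, hle⟩ := lemG (LinearMap.pi (fun _ : Fin 1 => φ)) d d le_rfl (by omega)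
  obtain ⟨b, hb, hbe⟩ := mem_IG.mp (hle ⟨p, hp, rfl⟩)
  have h1 := congrFun hbe 0
  simp only [LinearMap.pi_apply] at h1
  rw [← h1]
  rw [Nat.sub_self, formSpace, homogeneousSubmodule_zero, Submodule.mem_one] at hb
  obtain ⟨c, rfl⟩ := hb
  rw [mul_comm, ← Algebra.smul_def, map_smul, h l hl, smul_zero]

theorem lemGU {n d k j : ℕ} {U : Submodule ℂ (PolyR n)} (hU : U ≤ formSpace n d)
    (hc : vcodim n d U = k) (hjd : j ≤ d) (hk : k + j ≤ d + 1) :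
    ∃ l ∈ formSpace n 1, ∀ p ∈ formSpace n d, ∃ b ∈ formSpace n (d - j), p - l ^ j * b ∈ U := by
  obtain ⟨Φ, hΦ, -⟩ := lemPhi hU hc
  obtain ⟨l, hl, hle⟩ := lemG Φ d j hjd hk
  refine ⟨l, hl, fun p hp => ?_⟩
  obtain ⟨b, hb, hbe⟩ := mem_IG.mp (hle ⟨p, hp, rfl⟩)
  refine ⟨b, hb, ?_⟩
  have h1 : l ^ j * b ∈ formSpace n d := by
    have := mul_mem_fs (pow_mem_fs (a := j) hl) hb
    rwa [show j + (d - j) = d by omega] at this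
  rw [← hΦ _ (Submodule.sub_mem _ hp h1), map_sub, hbe, sub_self]

theorem mul_le_fs {n a b : ℕ} {U V : Submodule ℂ (PolyR n)} (hU : U ≤ formSpace n a)
    (hV : V ≤ formSpace n b) : U * V ≤ formSpace n (a + b) := by
  rw [← fs_mul]; exact mul_le_mul' hU hV

theorem sq_le_fs {n a : ℕ} {U : Submodule ℂ (PolyR n)} (hU : U ≤ formSpace n a) :
    U * U ≤ formSpace n (2 * a) := by
  rw [two_mul]; exact mul_le_fs hU hU

theorem step2 (N k : ℕ) (hk : 1 ≤ k) (d : ℕ) (hd : k ≤ d) :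
    ∀ U : Submodule ℂ (PolyR N), U ≤ formSpace N d → vcodim N d U = k →
      vcodim N (2 * d) (U * U) ≤ mMax N k k := by
  induction d, hd using Nat.le_induction with
  | base =>
    intro U hU hc
    refine le_csSup ⟨finrank ℂ (formSpace N (2 * k)), ?_⟩ ⟨U, hU, hc, rfl⟩
    rintro s ⟨V, -, -, rfl⟩
    exact Nat.sub_le _ _
  | succ d hd ih =>
    intro U hU hc
    obtain ⟨l, hl, hlU⟩ := lemGU (j := 2) hU hc (by omega) (by omega)
    simp only [show d + 1 - 2 = d - 1 by omega] at hlU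
    set V : Submodule ℂ (PolyR N) := U.comap (LinearMap.mulLeft ℂ l) ⊓ formSpace N d with hV
    have hVle : V ≤ formSpace N d := inf_le_right
    have hlA : ∀ {p e}, p ∈ formSpace N e → l * p ∈ formSpace N (e + 1) := by
      intro p e hp
      rw [add_comm]; exact mul_mem_fs hl hp
    have hVU : ∀ v ∈ V, l * v ∈ U := fun v hv => hv.1
    have hmapf : (formSpace N d).map (LinearMap.mulLeft ℂ l) ≤ formSpace N (d + 1) := by
      rintro _ ⟨p, hp, rfl⟩; exact hlA hp
    -- decomposition in degree `d`
    have hdec : ∀ p ∈ formSpace N d, ∃ v ∈ V, ∃ b ∈ formSpace N (d - 1), p = v + l * b := by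
      intro p hp
      obtain ⟨b, hb, hbU⟩ := hlU (l * p) (hlA hp)
      have hlb : l * b ∈ formSpace N d := by
        have := hlA hb
        rwa [show d - 1 + 1 = d by omega] at this
      refine ⟨p - l * b, ⟨?_, Submodule.sub_mem _ hp hlb⟩, b, hb, by ring⟩
      change l * (p - l * b) ∈ U
      convert hbU using 1; ring
    have hdecU : ∀ p ∈ formSpace N (d + 1), ∃ u ∈ U, ∃ a ∈ formSpace N d, p = u + l * a := by
      intro p hp
      obtain ⟨b, hb, hbU⟩ := hlU p hp
      have hlb : l * b ∈ formSpace N d := by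
        have := hlA hb
        rwa [show d - 1 + 1 = d by omega] at this
      exact ⟨_, hbU, _, hlb, by ring⟩
    have hVc : vcodim N d V = k := by
      apply le_antisymm
      · rw [← hc]
        exact lemC' hVle hU (LinearMap.mulLeft ℂ l) hmapf (fun p hp h => ⟨h, hp⟩)
          (by rintro _ ⟨p, hp, rfl⟩; exact hVU p hp)
      · rw [← hc]
        refine lemC hVle hU (LinearMap.mulLeft ℂ l) hmapf ?_
          (by rintro _ ⟨p, hp, rfl⟩; exact hVU p hp)
        intro p hp
        obtain ⟨u, hu, a, ha, rfl⟩ := hdecU p hp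
        exact Submodule.add_mem_sup hu ⟨a, ha, rfl⟩
    refine le_trans ?_ (ih V hVle hVc)
    refine lemC (sq_le_fs hVle) (sq_le_fs hU) (LinearMap.mulLeft ℂ (l ^ 2)) ?_ ?_ ?_
    · rintro _ ⟨p, hp, rfl⟩
      have := hlA (hlA hp)
      rw [LinearMap.mulLeft_apply, pow_two, mul_assoc]
      exact this
    · set T := U * U ⊔ (formSpace N (2 * d)).map (LinearMap.mulLeft ℂ (l ^ 2)) with hT
      have hUT : ∀ u ∈ U, ∀ u' ∈ U, u * u' ∈ T := fun u hu u' hu' =>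
        Submodule.mem_sup_left (Submodule.mul_mem_mul hu hu')
      have hlT : ∀ p ∈ formSpace N (2 * d), l ^ 2 * p ∈ T := fun p hp =>
        Submodule.mem_sup_right ⟨p, hp, rfl⟩
      have hmix : ∀ u ∈ U, ∀ a ∈ formSpace N d, u * (l * a) ∈ T := by
        intro u hu a ha
        obtain ⟨v, hv, b, hb, rfl⟩ := hdec a ha
        rw [show u * (l * (v + l * b)) = u * (l * v) + l ^ 2 * (u * b) by ring]
        refine Submodule.add_mem _ (hUT _ hu _ (hVU v hv)) (hlT _ ?_)
        have := mul_mem_fs (hU hu) hb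
        rwa [show d + 1 + (d - 1) = 2 * d by omega] at this
      rw [show 2 * (d + 1) = (d + 1) + (d + 1) by ring, ← fs_mul]
      rw [Submodule.mul_le]
      intro p hp q hq
      obtain ⟨u, hu, a, ha, rfl⟩ := hdecU p hp
      obtain ⟨u', hu', a', ha', rfl⟩ := hdecU q hq
      rw [show (u + l * a) * (u' + l * a') =
        u * u' + u * (l * a') + u' * (l * a) + l ^ 2 * (a * a') by ring]
      refine Submodule.add_mem _ (Submodule.add_mem _ (Submodule.add_mem _ (hUT _ hu _ hu')
        (hmix _ hu _ ha')) (hmix _ hu' _ ha)) (hlT _ ?_)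
      rw [two_mul]; exact mul_mem_fs ha ha'
    · rw [Submodule.map_le_iff_le_comap, Submodule.mul_le]
      intro v hv w hw
      rw [Submodule.mem_comap, LinearMap.mulLeft_apply]
      rw [show l ^ 2 * (v * w) = (l * v) * (l * w) by ring]
      exact Submodule.mul_mem_mul (hVU v hv) (hVU w hw)

theorem eq_of_vcodim_le {n d : ℕ} {U V : Submodule ℂ (PolyR n)} (hUV : U ≤ V)
    (hV : V ≤ formSpace n d) (h : vcodim n d U ≤ vcodim n d V) : U = V := by
  have := fd_of_le hV
  have h1 := Submodule.finrank_mono hUV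
  have := Submodule.finrank_mono hV
  refine Submodule.eq_of_le_of_finrank_le hUV ?_
  unfold vcodim at h
  omega

theorem exists_factor {E F : Type*} [AddCommGroup E] [Module ℂ E] [AddCommGroup F] [Module ℂ F]
    {G : Type*} [AddCommGroup G] [Module ℂ G] (a : E →ₗ[ℂ] F) (b : E →ₗ[ℂ] G)
    (ha : Function.Surjective a) (h : ∀ x, a x = 0 → b x = 0) : ∃ T : F →ₗ[ℂ] G, T ∘ₗ a = b := by
  obtain ⟨s, hs⟩ := a.exists_rightInverse_of_surjective (LinearMap.range_eq_top.mpr ha)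
  refine ⟨b ∘ₗ s, ?_⟩
  ext x
  have h1 : a (s (a x) - x) = 0 := by
    rw [map_sub, sub_eq_zero]
    exact LinearMap.congr_fun hs (a x)
  have h2 := h _ h1
  rw [map_sub, sub_eq_zero] at h2
  exact h2

theorem lemP_strict {n d : ℕ} {U : Submodule ℂ (PolyR n)} (hU : U ≤ formSpace n d)
    (hb : IsBPF n U) (h1 : 1 ≤ vcodim n d U) (h2 : vcodim n d U ≤ d) :
    vcodim n (d + 1) (U * formSpace n 1) < vcodim n d U := by
  by_contra hcon
  push Not at hcon
  obtain ⟨k, hk⟩ : ∃ k, vcodim n d U = k := ⟨_, rfl⟩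
  obtain ⟨Φ, hΦ, hΦs⟩ := lemPhi hU hk
  obtain ⟨l, hl, hlU⟩ := lemGU (j := 1) hU hk (by omega) (by omega)
  simp only [pow_one] at hlU
  have hlA : ∀ {p q e}, q ∈ formSpace n 1 → p ∈ formSpace n e → q * p ∈ formSpace n (e + 1) := by
    intro p q e hq hp
    rw [add_comm]; exact mul_mem_fs hq hp
  have hlA' : ∀ {p q}, q ∈ formSpace n 1 → p ∈ formSpace n (d - 1) → q * p ∈ formSpace n d := by
    intro p q hq hp
    have := hlA hq hp
    rwa [show d - 1 + 1 = d by omega] at this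
  have hUA : ∀ u ∈ U, ∀ m ∈ formSpace n 1, m * u ∈ U * formSpace n 1 := by
    intro u hu m hm
    rw [mul_comm m u]; exact Submodule.mul_mem_mul hu hm
  -- injectivity of multiplication by `l`
  have hinj : ∀ a ∈ formSpace n d, l * a ∈ U * formSpace n 1 → a ∈ U := by
    have hE : U = (U * formSpace n 1).comap (LinearMap.mulLeft ℂ l) ⊓ formSpace n d := by
      refine eq_of_vcodim_le ?_ inf_le_right (hcon.trans ?_)
      · intro u hu
        exact ⟨hUA u hu l hl, hU hu⟩
      · refine lemC inf_le_right (mul_le_fs hU le_rfl) (LinearMap.mulLeft ℂ l) ?_ ?_ ?_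
        · rintro _ ⟨p, hp, rfl⟩
          exact hlA hl hp
        · rw [← fs_mul, Submodule.mul_le]
          intro p hp m hm
          obtain ⟨b, hb, hbU⟩ := hlU p hp
          rw [show p * m = (p - l * b) * m + l * (m * b) by ring]
          exact Submodule.add_mem_sup (Submodule.mul_mem_mul hbU hm) ⟨_, hlA' hm hb, rfl⟩
        · rintro _ ⟨p, hp, rfl⟩
          exact hp.1
    intro a ha hla
    rw [hE]
    exact ⟨hla, ha⟩
  have hsurj : ∀ r : Fin k → ℂ, ∃ p ∈ formSpace n (d - 1), Φ (l * p) = r := by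
    intro r
    have : r ∈ (formSpace n d).map Φ := by rw [hΦs]; trivial
    obtain ⟨p, hp, rfl⟩ := this
    obtain ⟨b, hb, hbU⟩ := hlU p hp
    refine ⟨b, hb, ?_⟩
    have := (hΦ _ (hU hbU)).mpr hbU
    rw [map_sub, sub_eq_zero] at this
    exact this.symm
  have hzero : ∀ m ∈ formSpace n 1, ∀ p ∈ formSpace n (d - 1), Φ (l * p) = 0 → Φ (m * p) = 0 := by
    intro m hm p hp h0
    rw [hΦ _ (hlA' hl hp)] at h0
    rw [hΦ _ (hlA' hm hp)]
    refine hinj _ (hlA' hm hp) ?_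
    rw [show l * (m * p) = m * (l * p) by ring]
    exact hUA _ h0 _ hm
  have hT : ∀ i : Fin n, ∃ T : (Fin k → ℂ) →ₗ[ℂ] (Fin k → ℂ),
      ∀ p ∈ formSpace n (d - 1), T (Φ (l * p)) = Φ (X i * p) := by
    intro i
    obtain ⟨T, hT⟩ := exists_factor
      ((Φ ∘ₗ LinearMap.mulLeft ℂ l) ∘ₗ (formSpace n (d - 1)).subtype)
      ((Φ ∘ₗ LinearMap.mulLeft ℂ (X i)) ∘ₗ (formSpace n (d - 1)).subtype)
      (fun r => by obtain ⟨p, hp, h⟩ := hsurj r; exact ⟨⟨p, hp⟩, h⟩)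
      (fun p hp => hzero _ (X_mem_fs i) _ p.2 hp)
    exact ⟨T, fun p hp => LinearMap.congr_fun hT ⟨p, hp⟩⟩
  choose T hT using hT
  have hcomm : ∀ i j, T i * T j = T j * T i := by
    intro i j
    refine LinearMap.ext fun r => ?_
    obtain ⟨p, hp, rfl⟩ := hsurj r
    rw [Module.End.mul_apply, Module.End.mul_apply, hT j p hp, hT i p hp]
    obtain ⟨q, hq, hqU⟩ := hlU _ (hlA' (X_mem_fs j) hp)
    obtain ⟨q', hq', hqU'⟩ := hlU _ (hlA' (X_mem_fs i) hp)
    have e1 : Φ (X j * p) = Φ (l * q) := by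
      rw [← sub_eq_zero, ← map_sub]; exact (hΦ _ (hU hqU)).mpr hqU
    have e2 : Φ (X i * p) = Φ (l * q') := by
      rw [← sub_eq_zero, ← map_sub]; exact (hΦ _ (hU hqU')).mpr hqU'
    rw [e1, e2, hT i q hq, hT j q' hq', ← sub_eq_zero, ← map_sub]
    have hm : X i * q - X j * q' ∈ formSpace n d :=
      Submodule.sub_mem _ (hlA' (X_mem_fs i) hq) (hlA' (X_mem_fs j) hq')
    rw [hΦ _ hm]
    refine hinj _ hm ?_
    rw [show l * (X i * q - X j * q') = X j * (X i * p - l * q') - X i * (X j * p - l * q) by ring]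
    exact Submodule.sub_mem _ (hUA _ hqU' _ (X_mem_fs j)) (hUA _ hqU _ (X_mem_fs i))
  have hcomm' : ∀ a ∈ Set.range T, ∀ b ∈ Set.range T, a * b = b * a := by
    rintro _ ⟨i, rfl⟩ _ ⟨j, rfl⟩
    exact hcomm i j
  let _ : CommRing (Algebra.adjoin ℂ (Set.range T)) := Algebra.adjoinCommRingOfComm ℂ hcomm'
  let f : PolyR n →ₐ[ℂ] (Algebra.adjoin ℂ (Set.range T)) :=
    aeval (fun i => (⟨T i, Algebra.subset_adjoin ⟨i, rfl⟩⟩ : Algebra.adjoin ℂ (Set.range T)))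
  let g : PolyR n →ₗ[ℂ] Module.End ℂ (Fin k → ℂ) :=
    (Algebra.adjoin ℂ (Set.range T)).val.toLinearMap ∘ₗ f.toLinearMap
  have hgmul : ∀ p q, g (p * q) = g p * g q := by
    intro p q
    change ((f (p * q) : Algebra.adjoin ℂ (Set.range T)) : Module.End ℂ (Fin k → ℂ)) = _
    rw [map_mul]
    rfl
  have hgone : g 1 = 1 := by
    change ((f 1 : Algebra.adjoin ℂ (Set.range T)) : Module.End ℂ (Fin k → ℂ)) = _
    rw [map_one]; rfl
  have hgX : ∀ i, g (X i) = T i := by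
    intro i
    change ((f (X i) : Algebra.adjoin ℂ (Set.range T)) : Module.End ℂ (Fin k → ℂ)) = _
    rw [aeval_X]
  have hg1 : ∀ m ∈ formSpace n 1, ∀ p ∈ formSpace n (d - 1), g m (Φ (l * p)) = Φ (m * p) := by
    intro m hm p hp
    rw [formSpace, homogeneousSubmodule_one_eq_span_X] at hm
    induction hm using Submodule.span_induction with
    | mem x hx => obtain ⟨i, rfl⟩ := hx; rw [hgX, hT i p hp]
    | zero => simp
    | add x y _ _ hx hy => rw [map_add, LinearMap.add_apply, hx, hy, add_mul, map_add]
    | smul c x _ hx => rw [map_smul, LinearMap.smul_apply, hx, smul_mul_assoc, map_smul]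
  have hge : ∀ e, e ≤ d → ∀ p ∈ formSpace n e, ∀ q ∈ formSpace n (d - e),
      g p (Φ (l ^ e * q)) = Φ (p * q) := by
    intro e
    induction e with
    | zero =>
      intro _ p hp q hq
      rw [formSpace, homogeneousSubmodule_zero, Submodule.mem_one] at hp
      obtain ⟨c, rfl⟩ := hp
      rw [Algebra.algebraMap_eq_smul_one, map_smul, hgone]
      simp
    | succ e ih =>
      intro he p hp q hq
      rw [add_comm, ← fs_mul] at hp
      refine Submodule.mul_induction_on hp ?_ ?_
      · intro m hm p hp
        have hlq : l * q ∈ formSpace n (d - e) := by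
          have := mul_mem_fs hl hq
          rwa [show 1 + (d - (e + 1)) = d - e by omega] at this
        have hpq : p * q ∈ formSpace n (d - 1) := by
          have := mul_mem_fs hp hq
          rwa [show e + (d - (e + 1)) = d - 1 by omega] at this
        rw [hgmul, Module.End.mul_apply, show l ^ (e + 1) * q = l ^ e * (l * q) by ring,
          ih (by omega) p hp _ hlq, show p * (l * q) = l * (p * q) by ring, hg1 m hm _ hpq,
          mul_assoc]
      · intro x y hx hy
        rw [map_add, LinearMap.add_apply, hx, hy, add_mul, map_add]
  have hgd : ∀ p ∈ formSpace n d, g p (Φ (l ^ d)) = Φ p := by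
    intro p hp
    have := hge d le_rfl p hp 1 (by
      rw [Nat.sub_self, formSpace, homogeneousSubmodule_zero]; exact Submodule.one_le.mp le_rfl)
    simpa using this
  have hgU : ∀ u ∈ U, g u = 0 := by
    intro u hu
    refine LinearMap.ext fun r => ?_
    have : r ∈ (formSpace n d).map Φ := by rw [hΦs]; trivial
    obtain ⟨p, hp, rfl⟩ := this
    rw [← hgd p hp, ← Module.End.mul_apply, ← hgmul, mul_comm, hgmul, Module.End.mul_apply,
      hgd u (hU hu), (hΦ u (hU hu)).mpr hu, map_zero, LinearMap.zero_apply]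
  have hgl : g (l - 1) = 0 := by
    refine LinearMap.ext fun r => ?_
    obtain ⟨p, hp, rfl⟩ := hsurj r
    rw [map_sub, LinearMap.sub_apply, hg1 l hl p hp, hgone, Module.End.one_apply, sub_self,
      LinearMap.zero_apply]
  have hfg : ∀ p, g p = 0 → p ∈ RingHom.ker f := by
    intro p hp
    rw [RingHom.mem_ker]
    exact Subtype.ext hp
  have hne : RingHom.ker f ≠ ⊤ := by
    rw [Ideal.ne_top_iff_one]
    intro h
    have h3 : g 1 = 0 := congrArg Subtype.val ((RingHom.mem_ker).mp h)
    rw [hgone] at h3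
    have hk0 : 0 < k := by omega
    have h4 := congrFun (LinearMap.congr_fun h3 (fun _ => 1)) ⟨0, hk0⟩
    simp at h4
  obtain ⟨M, hM, hJM⟩ := Ideal.exists_le_maximal _ hne
  obtain ⟨x, hx⟩ := isMaximal_iff_eq_vanishingIdeal_singleton.mp hM
  have hev : ∀ p, g p = 0 → eval x p = 0 := by
    intro p hp
    have := hJM (hfg p hp)
    rw [hx] at this
    simpa using this
  have hx0 := hb x (fun u hu => hev u (hgU u hu))
  have h5 := hev _ hgl
  rw [map_sub, map_one, hx0] at h5
  have h6 : eval (0 : Fin n → ℂ) l = 0 := by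
    rw [eval_zero]
    exact (IsHomogeneous.coeff_eq_zero (n := 1) hl (d := 0) (by simp))
  rw [h6] at h5
  norm_num at h5

theorem bpf_mul {n : ℕ} {U : Submodule ℂ (PolyR n)} (hb : IsBPF n U) :
    IsBPF n (U * formSpace n 1) := by
  intro x hx
  by_contra hne
  obtain ⟨i, hi⟩ := Function.ne_iff.mp hne
  refine hne (hb x fun p hp => ?_)
  have := hx _ (Submodule.mul_mem_mul hp (X_mem_fs i))
  rw [map_mul, eval_X] at this
  exact (mul_eq_zero.mp this).resolve_right hi

theorem lemP {n : ℕ} (k : ℕ) : ∀ (d : ℕ) (U : Submodule ℂ (PolyR n)), U ≤ formSpace n d →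
    IsBPF n U → vcodim n d U ≤ k → k ≤ d → formSpace n (d + k) ≤ U * formSpace n k := by
  have hfull : ∀ (d : ℕ) (U : Submodule ℂ (PolyR n)), U ≤ formSpace n d → vcodim n d U = 0 →
      U = formSpace n d := by
    intro d U hU h
    exact eq_of_vcodim_le hU le_rfl (by omega)
  induction k with
  | zero =>
    intro d U hU hb hc _
    rw [hfull d U hU (by omega), fs_mul]
  | succ k ih =>
    intro d U hU hb hc hkd
    rcases Nat.eq_zero_or_pos (vcodim n d U) with h0 | h0
    · rw [hfull d U hU h0, fs_mul]
    · have h1 := lemP_strict hU hb h0 (by omega)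
      have h2 := ih (d + 1) (U * formSpace n 1) (mul_le_fs hU le_rfl) (bpf_mul hb) (by omega)
        (by omega)
      rw [mul_assoc, fs_mul] at h2
      rwa [show d + (k + 1) = d + 1 + k by ring, show k + 1 = 1 + k by ring]

theorem lemP' {n k d e : ℕ} (U : Submodule ℂ (PolyR n)) (hU : U ≤ formSpace n d)
    (hb : IsBPF n U) (hc : vcodim n d U ≤ k) (hkd : k ≤ d) (hke : k ≤ e) :
    formSpace n (d + e) ≤ U * formSpace n e := by
  have h := mul_le_mul_left (lemP k d U hU hb hc hkd) (formSpace n (e - k))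
  rw [fs_mul, mul_assoc, fs_mul] at h
  rwa [show d + k + (e - k) = d + e by omega, show k + (e - k) = e by omega] at h

noncomputable def piL {N n : ℕ} (c : Fin N → PolyR n) : PolyR N →ₗ[ℂ] PolyR n :=
  (aeval c : PolyR N →ₐ[ℂ] PolyR n).toLinearMap

theorem piL_apply {N n : ℕ} (c : Fin N → PolyR n) (p : PolyR N) : piL c p = aeval c p := rfl

theorem piL_map_mul {N n : ℕ} (c : Fin N → PolyR n) (P Q : Submodule ℂ (PolyR N)) :
    (P * Q).map (piL c) = P.map (piL c) * Q.map (piL c) :=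
  Submodule.map_mul P Q (aeval c : PolyR N →ₐ[ℂ] PolyR n)

theorem piL_map_fs {N n : ℕ} (c : Fin N → PolyR n) (d : ℕ) :
    (formSpace N d).map (piL c) = ((formSpace N 1).map (piL c)) ^ d := by
  rw [← fs_pow]
  exact Submodule.map_pow (formSpace N 1) (aeval c : PolyR N →ₐ[ℂ] PolyR n) d

theorem piL_one_le {N n : ℕ} (c : Fin N → PolyR n) (hc : ∀ i, c i ∈ formSpace n 1) :
    (formSpace N 1).map (piL c) ≤ formSpace n 1 := by
  rw [formSpace, homogeneousSubmodule_one_eq_span_X, Submodule.map_span, Submodule.span_le]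
  rintro _ ⟨_, ⟨i, rfl⟩, rfl⟩
  simp only [piL_apply, aeval_X]
  exact hc i

/-- Formal step. -/
theorem formalStep {n d : ℕ} (hd : 1 ≤ d) {U V : Submodule ℂ (PolyR n)}
    (hV : V ≤ formSpace n 1) (h1 : formSpace n d ≤ U ⊔ V ^ d)
    (h2 : V ^ (2 * d - 1) ≤ (U ⊓ V ^ d) * V ^ (d - 1)) :
    formSpace n (2 * d) ≤ U * U ⊔ V ^ (2 * d) := by
  have key : ∀ j, j ≤ 2 * d → formSpace n j * V ^ (2 * d - j) ≤ U * U ⊔ V ^ (2 * d) := by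
    intro j
    induction j using Nat.strong_induction_on with
    | _ j ih =>
      intro hj
      rcases Nat.eq_zero_or_pos j with rfl | hj0
      · rw [formSpace, homogeneousSubmodule_zero, one_mul]
        exact le_sup_right
      rcases Nat.eq_or_lt_of_le hj0 with rfl | hj1
      · calc formSpace n 1 * V ^ (2 * d - 1)
            ≤ formSpace n 1 * ((U ⊓ V ^ d) * V ^ (d - 1)) := mul_le_mul_right h2 _
          _ = (U ⊓ V ^ d) * (formSpace n 1 * V ^ (d - 1)) := by ring
          _ ≤ (U ⊓ V ^ d) * (formSpace n 1 * formSpace n 1 ^ (d - 1)) := by gcongr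
          _ = (U ⊓ V ^ d) * formSpace n d := by
              rw [fs_pow, fs_mul, show 1 + (d - 1) = d by omega]
          _ ≤ (U ⊓ V ^ d) * (U ⊔ V ^ d) := by gcongr
          _ = (U ⊓ V ^ d) * U ⊔ (U ⊓ V ^ d) * V ^ d := Submodule.mul_sup _ _ _
          _ ≤ U * U ⊔ V ^ d * V ^ d := by
              gcongr
              · exact inf_le_left
              · exact inf_le_right
          _ = U * U ⊔ V ^ (2 * d) := by rw [← pow_add, two_mul]
      · obtain ⟨i, i', hi, hi', rfl, hid, hid'⟩ : ∃ i i', 1 ≤ i ∧ 1 ≤ i' ∧ i + i' = j ∧ i ≤ d ∧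
            i' ≤ d := by
          refine ⟨j / 2, j - j / 2, ?_, ?_, ?_, ?_, ?_⟩ <;> omega
        have e1 : formSpace n (i + i') * V ^ (2 * d - (i + i')) =
            (formSpace n i * V ^ (d - i)) * (formSpace n i' * V ^ (d - i')) := by
          rw [← fs_mul, show 2 * d - (i + i') = (d - i) + (d - i') by omega, pow_add]
          ring
        have hsub : ∀ i, i ≤ d → formSpace n i * V ^ (d - i) ≤ U ⊔ V ^ d := by
          intro i hi
          calc formSpace n i * V ^ (d - i) ≤ formSpace n i * formSpace n 1 ^ (d - i) := by gcongr
            _ = formSpace n d := by rw [fs_pow, fs_mul, show i + (d - i) = d by omega]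
            _ ≤ _ := h1
        have ih1 : (formSpace n i * V ^ (d - i)) * V ^ d ≤ U * U ⊔ V ^ (2 * d) := by
          have := ih i (by omega) (by omega)
          rwa [show 2 * d - i = (d - i) + d by omega, pow_add, ← mul_assoc] at this
        have ih2 : (formSpace n i' * V ^ (d - i')) * V ^ d ≤ U * U ⊔ V ^ (2 * d) := by
          have := ih i' (by omega) (by omega)
          rwa [show 2 * d - i' = (d - i') + d by omega, pow_add, ← mul_assoc] at this
        rw [e1, Submodule.mul_le]
        intro x hx y hy
        obtain ⟨u, hu, b, hb, hxe⟩ := Submodule.mem_sup.mp (hsub i hid hx)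
        obtain ⟨u', hu', b', hb', hye⟩ := Submodule.mem_sup.mp (hsub i' hid' hy)
        have e2 : x * y = u * u' + x * b' + y * b - b * b' := by
          rw [← hxe, ← hye]; ring
        rw [e2]
        refine Submodule.sub_mem _ (Submodule.add_mem _ (Submodule.add_mem _ ?_ ?_) ?_) ?_
        · exact Submodule.mem_sup_left (Submodule.mul_mem_mul hu hu')
        · exact ih1 (Submodule.mul_mem_mul hx hb')
        · exact ih2 (Submodule.mul_mem_mul hy hb)
        · refine Submodule.mem_sup_right ?_
          rw [two_mul, pow_add]
          exact Submodule.mul_mem_mul hb hb'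
  have := key (2 * d) le_rfl
  simpa using this

/-- Reduction to `3k` variables, given good linear forms. -/
theorem step1 {n d k N : ℕ} (hk : 1 ≤ k) (hd : k + 1 ≤ d) {U : Submodule ℂ (PolyR n)}
    (hU : U ≤ formSpace n d) (hcod : vcodim n d U = k) (c : Fin N → PolyR n)
    (hc : ∀ i, c i ∈ formSpace n 1)
    (hsup : formSpace n d ≤ U ⊔ (formSpace N d).map (piL c))
    (hbpf : IsBPF N (U.comap (piL c) ⊓ formSpace N d)) :
    ∃ W : Submodule ℂ (PolyR N), W ≤ formSpace N d ∧ vcodim N d W = k ∧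
      vcodim n (2 * d) (U * U) ≤ vcodim N (2 * d) (W * W) := by
  set W := U.comap (piL c) ⊓ formSpace N d with hW
  set V := (formSpace N 1).map (piL c) with hV
  have hV1 : V ≤ formSpace n 1 := piL_one_le c hc
  have hWle : W ≤ formSpace N d := inf_le_right
  have hmap : ∀ e, (formSpace N e).map (piL c) ≤ formSpace n e := by
    intro e
    rw [piL_map_fs c e, ← fs_pow n e]
    exact pow_le_pow_left' hV1 e
  have hWU : W.map (piL c) ≤ U := by rintro _ ⟨p, hp, rfl⟩; exact hp.1
  have hWc : vcodim N d W = k := by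
    apply le_antisymm
    · rw [← hcod]
      exact lemC' hWle hU (piL c) (hmap d) (fun p hp h => ⟨h, hp⟩) hWU
    · rw [← hcod]
      exact lemC hWle hU (piL c) (hmap d) hsup hWU
  refine ⟨W, hWle, hWc, ?_⟩
  refine lemC (sq_le_fs hWle) (sq_le_fs hU) (piL c) (hmap _) ?_ ?_
  · rw [piL_map_fs]
    refine formalStep (by omega) hV1 (by rwa [piL_map_fs] at hsup) ?_
    have h1 := lemP' (e := d - 1) W hWle hbpf hWc.le (by omega) (by omega)
    have h2 := Submodule.map_mono (f := piL c) h1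
    rw [piL_map_mul, piL_map_fs c (d + (d - 1)), piL_map_fs c (d - 1), show d + (d - 1) = 2 * d - 1 by omega] at h2
    refine h2.trans ?_
    gcongr
    refine le_inf hWU ?_
    rw [← piL_map_fs]
    exact Submodule.map_mono hWle
  · rw [piL_map_mul]
    gcongr

noncomputable def evL {n : ℕ} (x : Fin n → ℂ) : PolyR n →ₗ[ℂ] ℂ :=
  (aeval x : PolyR n →ₐ[ℂ] ℂ).toLinearMap

theorem evL_apply {n : ℕ} (x : Fin n → ℂ) (p : PolyR n) : evL x p = eval x p := by
  simp [evL]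

theorem eval_lin {n : ℕ} (ψ : PolyR n →ₗ[ℂ] ℂ) (m : PolyR n) (hm : m ∈ formSpace n 1) :
    eval (fun i => ψ (X i)) m = ψ m := by
  rw [formSpace, homogeneousSubmodule_one_eq_span_X] at hm
  induction hm using Submodule.span_induction with
  | mem x hx => obtain ⟨i, rfl⟩ := hx; simp
  | zero => simp
  | add x y _ _ hx hy => rw [map_add, map_add, hx, hy]
  | smul c x _ hx => rw [smul_eval, hx, map_smul, smul_eq_mul]

theorem breakLemma {n d k : ℕ} (hd : 1 ≤ d) {U : Submodule ℂ (PolyR n)} (hU : U ≤ formSpace n d)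
    (hb : IsBPF n U) (Φ : PolyR n →ₗ[ℂ] (Fin k → ℂ)) (hΦ : ∀ u ∈ U, Φ u = 0)
    (l : Fin k → PolyR n) (hl : ∀ i, l i ∈ formSpace n 1)
    (hspan : Submodule.span ℂ (Set.range fun i => Φ (l i ^ d)) = ⊤)
    (y : (Fin k → ℂ) →ₗ[ℂ] ℂ) (hy : y ≠ 0) :
    ∃ m ∈ formSpace n 1, ∃ i,
      y (Φ (m ^ d)) * y (Φ (l i ^ d)) ^ (d - 1) ≠ y (Φ (l i ^ (d - 1) * m)) ^ d := by
  obtain ⟨i, hi⟩ : ∃ i, y (Φ (l i ^ d)) ≠ 0 := by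
    by_contra hcon
    push Not at hcon
    apply hy
    refine LinearMap.ext_on hspan ?_
    rintro _ ⟨i, rfl⟩
    simpa using hcon i
  by_contra hcon
  push Not at hcon
  obtain ⟨β, hβ⟩ := IsAlgClosed.exists_pow_nat_eq (y (Φ (l i ^ d))) (show 0 < d by omega)
  have hβ0 : β ≠ 0 := by
    rintro rfl
    rw [zero_pow (by omega)] at hβ
    exact hi hβ.symm
  let ψ : PolyR n →ₗ[ℂ] ℂ :=
    (β ^ (d - 1))⁻¹ • ((y ∘ₗ Φ) ∘ₗ LinearMap.mulLeft ℂ (l i ^ (d - 1)))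
  have hψ : ∀ m, ψ m = (β ^ (d - 1))⁻¹ * y (Φ (l i ^ (d - 1) * m)) := fun m => rfl
  let w : Fin n → ℂ := fun i => ψ (X i)
  have hpow : ∀ m ∈ formSpace n 1, (y ∘ₗ Φ - evL w) (m ^ d) = 0 := by
    intro m hm
    rw [LinearMap.sub_apply, sub_eq_zero, evL_apply, map_pow (eval w), eval_lin ψ m hm, hψ]
    have h1 := hcon m hm i
    rw [LinearMap.comp_apply, mul_pow, ← h1, ← hβ]
    have h2 : ((β ^ (d - 1))⁻¹) ^ d * (β ^ d) ^ (d - 1) = 1 := by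
      rw [inv_pow, ← pow_mul, ← pow_mul, mul_comm d (d - 1)]
      exact inv_mul_cancel₀ (pow_ne_zero _ hβ0)
    rw [mul_left_comm, h2, mul_one]
  have hall := lemPow _ hpow
  have hall' : ∀ p ∈ formSpace n d, y (Φ p) = eval w p := by
    intro p hp
    have := hall p hp
    rwa [LinearMap.sub_apply, sub_eq_zero, evL_apply] at this
  have hw : w = 0 := by
    refine hb w fun u hu => ?_
    rw [← hall' u (hU hu), hΦ u hu, map_zero]
  apply hi
  rw [hall' _ (pow_mem_fs (hl i)), map_pow, eval_lin ψ _ (hl i)]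
  have h2 : ψ (l i) = eval w (l i) := (eval_lin ψ _ (hl i)).symm
  rw [h2, hw]
  have h3 := eval_lin (0 : PolyR n →ₗ[ℂ] ℂ) _ (hl i)
  simp only [LinearMap.zero_apply] at h3
  rw [show (0 : Fin n → ℂ) = fun _ => 0 from rfl, h3, zero_pow (by omega)]

theorem sepLemma {k : ℕ} (x z : Fin k → ℂ) (h : ∀ c : ℂ, x ≠ c • z) :
    ∃ p ∈ formSpace k 1, eval z p = 0 ∧ eval x p ≠ 0 := by
  have hx : x ∉ Submodule.span ℂ {z} := by
    intro hx
    obtain ⟨c, hc⟩ := Submodule.mem_span_singleton.mp hx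
    exact h c hc.symm
  obtain ⟨f, hfx, hf⟩ := Submodule.exists_le_ker_of_notMem hx
  have hev : ∀ v : Fin k → ℂ, eval v (∑ i, f (Pi.single i 1) • X i : PolyR k) = f v := by
    intro v
    rw [map_sum, LinearMap.pi_apply_eq_sum_univ f v]
    refine Finset.sum_congr rfl fun i _ => ?_
    rw [smul_eval, eval_X, smul_eq_mul, mul_comm]
    congr 2
    funext j
    simp [Pi.single_apply, eq_comm]
  refine ⟨∑ i, f (Pi.single i 1) • X i, ?_, ?_, ?_⟩
  · exact Submodule.sum_mem _ fun i _ => Submodule.smul_mem _ _ (X_mem_fs i)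
  · rw [hev]
    exact hf (Submodule.mem_span_singleton_self z)
  · rw [hev]; exact hfx

theorem badMultiple {n d k s : ℕ} (hd : 1 ≤ d) (hs : s ≤ d) (Φ : PolyR n →ₗ[ℂ] (Fin k → ℂ))
    (l : Fin k → PolyR n)
    (hspan : Submodule.span ℂ (Set.range fun i => Φ (l i ^ d)) = ⊤)
    (y : (Fin k → ℂ) →ₗ[ℂ] ℂ) (hy : y ≠ 0) (x : Fin k → ℂ)
    (hyx : ∀ p ∈ formSpace k d, y (Φ (piL l p)) = eval x p)
    (Y : Fin s → ((Fin k → ℂ) →ₗ[ℂ] ℂ)) (z : Fin s → Fin k → ℂ)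
    (hYz : ∀ j, ∀ p ∈ formSpace k d, Y j (Φ (piL l p)) = eval (z j) p)
    (hmem : y ∈ Submodule.span ℂ (Set.range Y)) : ∃ j, ∃ a : ℂ, y = a • Y j := by
  have hXd : ∀ i : Fin k, (X i ^ d : PolyR k) ∈ formSpace k d := fun i => pow_mem_fs (X_mem_fs i)
  have hpX : ∀ i : Fin k, piL l (X i ^ d) = l i ^ d := by
    intro i
    simp [piL_apply]
  obtain ⟨j, c, hc⟩ : ∃ j, ∃ c : ℂ, x = c • z j := by
    by_contra hcon
    push Not at hcon
    choose h hh1 hhz hhx using fun j => sepLemma x (z j) (hcon j)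
    have hx0 : x ≠ 0 := by
      rintro rfl
      apply hy
      refine LinearMap.ext_on hspan ?_
      rintro _ ⟨i, rfl⟩
      have := hyx _ (hXd i)
      rw [hpX] at this
      rw [this]
      simp; omega
    obtain ⟨h0, hh01, -, hh0x⟩ := sepLemma x 0 (by simpa using hx0)
    have hp : (∏ j, h j) * h0 ^ (d - s) ∈ formSpace k d := by
      have h1 : (∏ j, h j) ∈ formSpace k s := by
        have := IsHomogeneous.prod Finset.univ h (fun _ => 1) (fun j _ => hh1 j)
        rw [Finset.sum_const, Finset.card_univ, Fintype.card_fin, smul_eq_mul, mul_one] at this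
        exact this
      have := mul_mem_fs h1 (pow_mem_fs (a := d - s) hh01)
      rwa [show s + (d - s) = d by omega] at this
    have hne : eval x ((∏ j, h j) * h0 ^ (d - s)) ≠ 0 := by
      rw [map_mul, map_prod, map_pow]
      exact mul_ne_zero (Finset.prod_ne_zero_iff.mpr fun j _ => hhx j) (pow_ne_zero _ hh0x)
    apply hne
    rw [← hyx _ hp]
    obtain ⟨a, rfl⟩ := (Submodule.mem_span_range_iff_exists_fun ℂ).mp hmem
    rw [LinearMap.sum_apply]
    refine Finset.sum_eq_zero fun j _ => ?_
    rw [LinearMap.smul_apply, hYz j _ hp, map_mul, map_prod,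
      Finset.prod_eq_zero (Finset.mem_univ j) (hhz j)]
    simp
  refine ⟨j, c ^ d, ?_⟩
  refine LinearMap.ext_on hspan ?_
  rintro _ ⟨i, rfl⟩
  have h1 := hyx _ (hXd i)
  have h2 := hYz j _ (hXd i)
  rw [hpX] at h1 h2
  rw [LinearMap.smul_apply]
  dsimp only
  rw [h1, h2, hc]
  simp [mul_pow]

theorem choice {n d k : ℕ} (hk : 1 ≤ k) (hd : k + 1 ≤ d) {U : Submodule ℂ (PolyR n)}
    (hU : U ≤ formSpace n d) (hb : IsBPF n U) (hcod : vcodim n d U = k) :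
    ∃ c : Fin (3 * k) → PolyR n, (∀ i, c i ∈ formSpace n 1) ∧
      formSpace n d ≤ U ⊔ (formSpace (3 * k) d).map (piL c) ∧
      IsBPF (3 * k) (U.comap (piL c) ⊓ formSpace (3 * k) d) := by
  obtain ⟨Φ, hΦ, hΦs⟩ := lemPhi hU hcod
  have hΦU : ∀ u ∈ U, Φ u = 0 := fun u hu => (hΦ u (hU hu)).mpr hu
  -- the linear forms `l`
  obtain ⟨l, hl, hspan⟩ : ∃ l : Fin k → PolyR n, (∀ i, l i ∈ formSpace n 1) ∧
      Submodule.span ℂ (Set.range fun i => Φ (l i ^ d)) = ⊤ := by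
    let S : Set (Fin k → ℂ) := (fun m => Φ (m ^ d)) '' (formSpace n 1 : Set (PolyR n))
    have hS : Submodule.span ℂ S = ⊤ := by
      by_contra hne
      obtain ⟨f, hf0, hf⟩ := Submodule.exists_le_ker_of_lt_top _ (lt_top_iff_ne_top.mpr hne)
      apply hf0
      have h1 := lemPow (d := d) (f ∘ₗ Φ) (fun m hm =>
        hf (Submodule.subset_span ⟨m, hm, rfl⟩))
      refine LinearMap.ext fun r => ?_
      have : r ∈ (formSpace n d).map Φ := by rw [hΦs]; trivial
      obtain ⟨p, hp, rfl⟩ := this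
      exact h1 p hp
    have hfr : finrank ℂ (Submodule.span ℂ S) = k := by
      rw [hS, finrank_top]; simp
    have hex := Submodule.exists_fun_fin_finrank_span_eq ℂ S
    rw [hfr] at hex
    obtain ⟨f, hfS, hfspan, -⟩ := hex
    choose l hl hlf using hfS
    refine ⟨l, hl, ?_⟩
    rw [← hS, ← hfspan]
    congr 2
    funext i
    exact hlf i
  -- the bad functionals
  let B : Set ((Fin k → ℂ) →ₗ[ℂ] ℂ) :=
    {y | y ≠ 0 ∧ ∃ x : Fin k → ℂ, ∀ p ∈ formSpace k d, y (Φ (piL l p)) = eval x p}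
  obtain ⟨s, hs, Y, hYB, hYspan⟩ : ∃ s, s ≤ k ∧ ∃ Y : Fin s → ((Fin k → ℂ) →ₗ[ℂ] ℂ),
      (∀ i, Y i ∈ B) ∧ Submodule.span ℂ (Set.range Y) = Submodule.span ℂ B := by
    obtain ⟨f, h1, h2, -⟩ := Submodule.exists_fun_fin_finrank_span_eq ℂ B
    refine ⟨_, ?_, f, h1, h2⟩
    refine (Submodule.finrank_le _).trans ?_
    have := Subspace.dual_finrank_eq (K := ℂ) (V := Fin k → ℂ)
    rw [finrank_fintype_fun_eq_card, Fintype.card_fin] at this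
    exact this.le
  choose hY0 z hYz using hYB
  choose m hm im hbreak using fun j => breakLemma (by omega) hU hb Φ hΦU l hl hspan (Y j) (hY0 j)
  let c : Fin (3 * k) → PolyR n := fun i =>
    if h : i.1 < k then l ⟨i.1, h⟩ else if h : i.1 - k < s then m ⟨i.1 - k, h⟩ else 0
  let ι : Fin k → Fin (3 * k) := fun i => ⟨i.1, by omega⟩
  let κ : Fin s → Fin (3 * k) := fun j => ⟨k + j.1, by omega⟩
  have hcι : ∀ i, c (ι i) = l i := by
    intro i
    simp [c, ι]
  have hcκ : ∀ j, c (κ j) = m j := by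
    intro j
    simp [c, κ]
  have hc1 : ∀ i, c i ∈ formSpace n 1 := by
    intro i
    simp only [c]
    split_ifs
    · exact hl _
    · exact hm _
    · exact Submodule.zero_mem _
  have hmapd : ∀ p ∈ formSpace (3 * k) d, piL c p ∈ formSpace n d := by
    intro p hp
    have : piL c p ∈ (formSpace (3 * k) d).map (piL c) := ⟨p, hp, rfl⟩
    rw [piL_map_fs] at this
    rw [← fs_pow]
    exact pow_le_pow_left' (piL_one_le c hc1) d this
  have hXd : ∀ i : Fin (3 * k), (X i ^ d : PolyR (3 * k)) ∈ formSpace (3 * k) d :=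
    fun i => pow_mem_fs (X_mem_fs i)
  have hpX : ∀ i, piL c (X i ^ d) = c i ^ d := by
    intro i; simp [piL_apply]
  have hsurj : ((formSpace (3 * k) d).map (piL c)).map Φ = ⊤ := by
    rw [eq_top_iff, ← hspan, Submodule.span_le]
    rintro _ ⟨i, rfl⟩
    refine ⟨l i ^ d, ⟨X (ι i) ^ d, hXd _, ?_⟩, rfl⟩
    rw [hpX, hcι]
  refine ⟨c, hc1, ?_, ?_⟩
  · intro p hp
    have : Φ p ∈ ((formSpace (3 * k) d).map (piL c)).map Φ := by rw [hsurj]; trivial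
    obtain ⟨_, ⟨q, hq, rfl⟩, hqe⟩ := this
    rw [show p = (p - piL c q) + piL c q by ring]
    refine Submodule.add_mem_sup ?_ ⟨q, hq, rfl⟩
    rw [← hΦ _ (Submodule.sub_mem _ hp (hmapd q hq)), map_sub, hqe, sub_self]
  · intro x hx
    obtain ⟨y, hy⟩ := exists_factor
      ((Φ ∘ₗ piL c) ∘ₗ (formSpace (3 * k) d).subtype)
      (evL x ∘ₗ (formSpace (3 * k) d).subtype)
      (by
        intro r
        have : r ∈ ((formSpace (3 * k) d).map (piL c)).map Φ := by rw [hsurj]; trivial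
        obtain ⟨_, ⟨q, hq, rfl⟩, hqe⟩ := this
        exact ⟨⟨q, hq⟩, hqe⟩)
      (by
        intro p hp
        have h1 : Φ (piL c p) = 0 := hp
        rw [hΦ _ (hmapd p p.2)] at h1
        rw [LinearMap.comp_apply, evL_apply]
        exact hx p ⟨h1, p.2⟩)
    have hyx : ∀ p ∈ formSpace (3 * k) d, y (Φ (piL c p)) = eval x p := by
      intro p hp
      rw [← evL_apply]
      exact LinearMap.congr_fun hy ⟨p, hp⟩
    by_contra hx0
    have hy0 : y ≠ 0 := by
      rintro rfl
      apply hx0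
      funext i
      have := hyx _ (hXd i)
      rw [LinearMap.zero_apply, map_pow, eval_X] at this
      exact pow_eq_zero_iff (by omega) |>.mp this.symm
    have hyι : ∀ p ∈ formSpace k d, y (Φ (piL l p)) = eval (x ∘ ι) p := by
      intro p hp
      have h1 := hyx (rename ι p) (IsHomogeneous.rename_isHomogeneous hp)
      rw [eval_rename, piL_apply, aeval_rename, show c ∘ ι = l from funext hcι] at h1
      exact h1
    have hyB : y ∈ Submodule.span ℂ (Set.range Y) := by
      rw [hYspan]
      exact Submodule.subset_span ⟨hy0, _, hyι⟩
    obtain ⟨j, a, ha⟩ := badMultiple (by omega) (by omega) Φ l hspan y hy0 (x ∘ ι) hyι Y z hYz hyB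
    have ha0 : a ≠ 0 := by
      rintro rfl
      exact hy0 (by rw [ha, zero_smul])
    apply hbreak j
    have e1 := hyx _ (hXd (κ j))
    have e2 := hyx _ (hXd (ι (im j)))
    have e3 := hyx (X (ι (im j)) ^ (d - 1) * X (κ j)) (by
      have := mul_mem_fs (pow_mem_fs (a := d - 1) (X_mem_fs (ι (im j)))) (X_mem_fs (κ j))
      rwa [show d - 1 + 1 = d by omega] at this)
    rw [hpX, hcκ, map_pow (eval x), eval_X, ha, LinearMap.smul_apply, smul_eq_mul] at e1
    rw [hpX, hcι, map_pow (eval x), eval_X, ha, LinearMap.smul_apply, smul_eq_mul] at e2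
    rw [piL_apply, map_mul (aeval c), map_pow (aeval c), aeval_X, aeval_X, hcκ, hcι,
      map_mul (eval x), map_pow (eval x), eval_X, eval_X, ha, LinearMap.smul_apply, smul_eq_mul] at e3
    obtain ⟨e, rfl⟩ : ∃ e, d = e + 1 := ⟨d - 1, by omega⟩
    simp only [Nat.add_sub_cancel] at e1 e2 e3 ⊢
    have had : a ^ (e + 1) ≠ 0 := pow_ne_zero _ ha0
    apply mul_left_cancel₀ had
    rw [← mul_pow, e3]
    calc _ = (a * (Y j) (Φ (m j ^ (e + 1)))) * (a * (Y j) (Φ (l (im j) ^ (e + 1)))) ^ e := by ring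
      _ = _ := by rw [e1, e2]; ring

theorem stmt0 (k d n : ℕ) (hk : 1 ≤ k) (hd : k + 1 ≤ d) (hn : 2 ≤ n)
    (U : Submodule ℂ (PolyR n)) (hU : U ≤ formSpace n d)
    (hbpf : IsBPF n U) (hcodim : vcodim n d U = k) :
    vcodim n (2 * d) (U * U) ≤ mMax (3 * k) k k := by
  obtain ⟨c, hc1, hsup, hW⟩ := choice hk hd hU hbpf hcodim
  obtain ⟨W, hWle, hWc, hle⟩ := step1 hk hd hU hcodim c hc1 hsup hW
  exact hle.trans (step2 (3 * k) k hk d (by omega) W hWle hWc)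
end

section
/- For all n, d ≥ 2 and every k ≥ 1 with k ≤ dim A(n)_d, there exists a strongly stable monomial subspace U ⊆ A(n)_d of codimension k such that codim U² = m(n, d, k); that is, the maximum of codim U² over all codimension-k subspaces is attained by a strongly stable subspace. -/
open MvPolynomial Module

/-- `U` is spanned by monomials. -/
def IsMonomialSubspace (n : ℕ) (U : Submodule ℂ (PolyR n)) : Prop :=
  ∃ S : Set (Fin n →₀ ℕ),
    U = Submodule.span ℂ ((fun α => (monomial α (1 : ℂ) : PolyR n)) '' S)

/-- A strongly stable monomial subspace (with respect to `x₁ < ⋯ < xₙ`). -/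
def IsStronglyStable (n : ℕ) (U : Submodule ℂ (PolyR n)) : Prop :=
  IsMonomialSubspace n U ∧
  ∀ α : Fin n →₀ ℕ, (monomial α (1 : ℂ) : PolyR n) ∈ U →
    ∀ i j : Fin n, i < j → α i ≠ 0 →
      (monomial (α - Finsupp.single i 1 + Finsupp.single j 1) (1 : ℂ) : PolyR n) ∈ U

open scoped Pointwise

section Comb
variable {n : ℕ}

/-- Merge the exponent of `x_i` into that of `x_j`. -/
noncomputable def mergeExp (i j : Fin n) (α : Fin n →₀ ℕ) : Fin n →₀ ℕ :=
  α.erase i + Finsupp.single j (α i)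

/-- Replace the exponent of `x_i` by `r`, moving the rest to `x_j`. -/
noncomputable def moveExp (i j : Fin n) (r : ℕ) (α : Fin n →₀ ℕ) : Fin n →₀ ℕ :=
  α.erase i + Finsupp.single i r + Finsupp.single j (α i - r)

lemma mergeExp_add (i j : Fin n) (α β : Fin n →₀ ℕ) :
    mergeExp i j (α + β) = mergeExp i j α + mergeExp i j β := by
  unfold mergeExp
  rw [Finsupp.erase_add, Finsupp.add_apply, Finsupp.single_add]
  abel

lemma moveExp_apply_self {i j : Fin n} (h : i ≠ j) (r : ℕ) (α : Fin n →₀ ℕ) :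
    moveExp i j r α i = r := by
  simp [moveExp, Finsupp.single_eq_of_ne, h]

lemma mergeExp_moveExp {i j : Fin n} (h : i ≠ j) {r : ℕ} {α : Fin n →₀ ℕ} (hr : r ≤ α i) :
    mergeExp i j (moveExp i j r α) = mergeExp i j α := by
  have h1 := moveExp_apply_self h r α
  rw [mergeExp, h1, moveExp, mergeExp, Finsupp.erase_add, Finsupp.erase_add,
    Finsupp.erase_single, Finsupp.erase_single_ne h, Finsupp.erase_idem, add_zero, add_assoc,
    ← Finsupp.single_add, Nat.sub_add_cancel hr]

lemma mergeExp_inj {i j : Fin n} {α β : Fin n →₀ ℕ}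
    (hm : mergeExp i j α = mergeExp i j β) (hi : α i = β i) : α = β := by
  unfold mergeExp at hm
  rw [hi] at hm
  have := add_right_cancel hm
  rw [← Finsupp.single_add_erase i α, ← Finsupp.single_add_erase i β, this, hi]

/-- Rank of `α` in its fibre. -/
noncomputable def rk (S : Finset (Fin n →₀ ℕ)) (i j : Fin n) (α : Fin n →₀ ℕ) : ℕ :=
  (S.filter fun β => mergeExp i j β = mergeExp i j α ∧ β i < α i).card

lemma rk_image (S : Finset (Fin n →₀ ℕ)) (i j : Fin n) (α : Fin n →₀ ℕ) :
    ((S.filter fun β => mergeExp i j β = mergeExp i j α ∧ β i < α i).image (fun β => β i)).card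
      = rk S i j α := by
  apply Finset.card_image_of_injOn
  intro a ha b hb hab
  simp only [Finset.coe_filter, Set.mem_ofPred_eq] at ha hb
  exact mergeExp_inj (ha.2.1.trans hb.2.1.symm) hab

lemma rk_image_sub (S : Finset (Fin n →₀ ℕ)) (i j : Fin n) (α : Fin n →₀ ℕ) :
    ((S.filter fun β => mergeExp i j β = mergeExp i j α ∧ β i < α i).image (fun β => β i))
      ⊆ Finset.range (α i) := by
  intro a ha
  simp only [Finset.mem_image, Finset.mem_filter] at ha
  obtain ⟨b, hb, rfl⟩ := ha
  simpa using hb.2.2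

lemma rk_le (S : Finset (Fin n →₀ ℕ)) (i j : Fin n) (α : Fin n →₀ ℕ) : rk S i j α ≤ α i := by
  rw [← rk_image]
  simpa using Finset.card_le_card (rk_image_sub S i j α)

lemma rk_lt_card (S : Finset (Fin n →₀ ℕ)) (i j : Fin n) {α : Fin n →₀ ℕ} (hα : α ∈ S) :
    rk S i j α < (S.filter fun β => mergeExp i j β = mergeExp i j α).card := by
  apply Finset.card_lt_card
  rw [Finset.ssubset_iff_of_subset]
  · exact ⟨α, by simp [hα], by simp⟩
  · intro b hb
    simp only [Finset.mem_filter] at hb ⊢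
    exact ⟨hb.1, hb.2.1⟩

lemma rk_strict (S : Finset (Fin n →₀ ℕ)) (i j : Fin n) {α β : Fin n →₀ ℕ} (hα : α ∈ S)
    (hm : mergeExp i j α = mergeExp i j β) (hlt : α i < β i) : rk S i j α < rk S i j β := by
  apply Finset.card_lt_card
  rw [Finset.ssubset_iff_of_subset]
  · exact ⟨α, by simp [hα, hm, hlt], by simp⟩
  · intro b hb
    simp only [Finset.mem_filter] at hb ⊢
    exact ⟨hb.1, hb.2.1.trans hm, hb.2.2.trans hlt⟩

/-- The compression map. -/
noncomputable def cmap (S : Finset (Fin n →₀ ℕ)) (i j : Fin n) (α : Fin n →₀ ℕ) : Fin n →₀ ℕ :=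
  moveExp i j (rk S i j α) α

lemma cmap_injOn (S : Finset (Fin n →₀ ℕ)) {i j : Fin n} (h : i ≠ j) :
    Set.InjOn (cmap S i j) S := by
  intro a ha b hb hab
  have h1 : mergeExp i j a = mergeExp i j b := by
    rw [← mergeExp_moveExp h (rk_le S i j a), ← mergeExp_moveExp h (rk_le S i j b)]
    exact congrArg _ hab
  have h2 : rk S i j a = rk S i j b := by
    rw [← moveExp_apply_self h (rk S i j a) a, ← moveExp_apply_self h (rk S i j b) b]
    exact congrArg (fun f => f i) hab
  rcases lt_trichotomy (a i) (b i) with hl | hl | hl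
  · exact absurd h2 (rk_strict S i j ha h1 hl).ne
  · exact mergeExp_inj h1 hl
  · exact absurd h2 (rk_strict S i j hb h1.symm hl).ne'

lemma compress_add_card (S : Finset (Fin n →₀ ℕ)) {i j : Fin n} (h : i ≠ j) :
    (S.image (cmap S i j) + S.image (cmap S i j)).card ≤ (S + S).card := by
  classical
  set C := S.image (cmap S i j) with hC
  -- fibre bound
  have key : ∀ γ ∈ C + C,
      γ i < ((S + S).filter fun δ => mergeExp i j δ = mergeExp i j γ).card := by
    intro γ hγ
    obtain ⟨a', ha', b', hb', rfl⟩ := Finset.mem_add.1 hγ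
    obtain ⟨a, ha, rfl⟩ := Finset.mem_image.1 ha'
    obtain ⟨b, hb, rfl⟩ := Finset.mem_image.1 hb'
    have ma : mergeExp i j (cmap S i j a) = mergeExp i j a := mergeExp_moveExp h (rk_le S i j a)
    have mb : mergeExp i j (cmap S i j b) = mergeExp i j b := mergeExp_moveExp h (rk_le S i j b)
    have ia : cmap S i j a i = rk S i j a := moveExp_apply_self h _ _
    have ib : cmap S i j b i = rk S i j b := moveExp_apply_self h _ _
    rw [Finsupp.add_apply, ia, ib, mergeExp_add, ma, mb]
    set A := (S.filter fun β => mergeExp i j β = mergeExp i j a) with hA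
    set B := (S.filter fun β => mergeExp i j β = mergeExp i j b) with hB
    have h1 : rk S i j a < A.card := rk_lt_card S i j ha
    have h2 : rk S i j b < B.card := rk_lt_card S i j hb
    have cA : (A.image fun β => β i).card = A.card := by
      apply Finset.card_image_of_injOn
      intro x hx y hy hxy
      simp only [hA, Finset.coe_filter, Set.mem_ofPred_eq] at hx hy
      exact mergeExp_inj (hx.2.trans hy.2.symm) hxy
    have cB : (B.image fun β => β i).card = B.card := by
      apply Finset.card_image_of_injOn
      intro x hx y hy hxy
      simp only [hB, Finset.coe_filter, Set.mem_ofPred_eq] at hx hy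
      exact mergeExp_inj (hx.2.trans hy.2.symm) hxy
    have nA : A.Nonempty := ⟨a, by simp [hA, ha]⟩
    have nB : B.Nonempty := ⟨b, by simp [hB, hb]⟩
    have h3 := cauchy_davenport_add_of_linearOrder_isCancelAdd
      (nA.image fun β => β i) (nB.image fun β => β i)
    rw [cA, cB] at h3
    have h4 : (A.image fun β => β i) + (B.image fun β => β i)
        ⊆ ((S + S).filter fun δ => mergeExp i j δ = mergeExp i j a + mergeExp i j b).image
            (fun β => β i) := by
      intro x hx
      obtain ⟨y, hy, z, hz, rfl⟩ := Finset.mem_add.1 hx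
      obtain ⟨u, hu, rfl⟩ := Finset.mem_image.1 hy
      obtain ⟨v, hv, rfl⟩ := Finset.mem_image.1 hz
      simp only [hA, hB, Finset.mem_filter] at hu hv
      refine Finset.mem_image.2 ⟨u + v, ?_, by simp⟩
      rw [Finset.mem_filter, mergeExp_add, hu.2, hv.2]
      exact ⟨Finset.add_mem_add hu.1 hv.1, rfl⟩
    have h5 := (Finset.card_le_card h4).trans Finset.card_image_le
    omega
  have hmaps : ∀ γ ∈ C + C, mergeExp i j γ ∈ (S + S).image (mergeExp i j) := by
    intro γ hγ
    have := key γ hγ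
    obtain ⟨δ, hδ⟩ := Finset.card_pos.1 (Nat.zero_lt_of_lt this)
    rw [Finset.mem_filter] at hδ
    exact Finset.mem_image.2 ⟨δ, hδ.1, hδ.2⟩
  rw [Finset.card_eq_sum_card_fiberwise (f := mergeExp i j) hmaps,
    Finset.card_eq_sum_card_fiberwise (s := S + S) (f := mergeExp i j)
      (t := (S + S).image (mergeExp i j)) (fun x hx => Finset.mem_image_of_mem _ hx)]
  apply Finset.sum_le_sum
  intro v hv
  rw [← Finset.card_range (((S + S).filter fun δ => mergeExp i j δ = v).card)]
  apply Finset.card_le_card_of_injOn (fun γ => γ i)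
  · intro γ hγ
    simp only [Finset.coe_filter, Set.mem_ofPred_eq] at hγ
    have := key γ hγ.1
    rw [hγ.2] at this
    simpa using this
  · intro x hx y hy hxy
    simp only [Finset.coe_filter, Set.mem_ofPred_eq] at hx hy
    exact mergeExp_inj (hx.2.trans hy.2.symm) hxy

/-- potential -/
noncomputable def wt (α : Fin n →₀ ℕ) : ℕ := Finsupp.weight (fun l : Fin n => n - (l : ℕ)) α

lemma wt_move {i j : Fin n} (h : i < j) {r : ℕ} {α : Fin n →₀ ℕ} (hr : r ≤ α i) :
    wt (moveExp i j r α) + (α i - r) * ((j : ℕ) - i) = wt α := by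
  conv_rhs => rw [← Finsupp.single_add_erase i α]
  simp only [wt, moveExp, map_add, Finsupp.weight_single, smul_eq_mul]
  obtain ⟨s, hs⟩ := Nat.exists_eq_add_of_le hr
  obtain ⟨t, ht⟩ := Nat.exists_eq_add_of_le (Nat.le_of_lt (Fin.lt_def.1 h))
  obtain ⟨u, hu⟩ := Nat.exists_eq_add_of_le j.2.le
  have e1 : n - (j : ℕ) = u := by omega
  have e2 : n - (i : ℕ) = t + u := by omega
  have e3 : (j : ℕ) - i = t := by omega
  have e4 : α i - r = s := by omega
  rw [e1, e2, e3, e4, hs]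
  ring

lemma degree_move {i j : Fin n} {r : ℕ} {α : Fin n →₀ ℕ} (hr : r ≤ α i) :
    (moveExp i j r α).degree = α.degree := by
  conv_rhs => rw [← Finsupp.single_add_erase i α]
  simp only [moveExp, map_add, Finsupp.degree_single]
  omega

lemma exists_stable (d M : ℕ) : ∀ (w : ℕ) (S : Finset (Fin n →₀ ℕ)), ∑ α ∈ S, wt α = w →
    (∀ α ∈ S, α.degree = d) → (S + S).card ≤ M →
    ∃ T : Finset (Fin n →₀ ℕ), T.card = S.card ∧ (∀ α ∈ T, α.degree = d) ∧ (T + T).card ≤ M ∧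
      ∀ α ∈ T, ∀ i j : Fin n, i < j → α i ≠ 0 →
        α - Finsupp.single i 1 + Finsupp.single j 1 ∈ T := by
  intro w
  induction w using Nat.strong_induction_on with
  | _ w ih =>
  intro S hw hd hM
  by_cases hst : ∀ i j : Fin n, i < j → ∀ α ∈ S, rk S i j α = α i
  · refine ⟨S, rfl, hd, hM, ?_⟩
    intro α hα i j hij hne
    have h1 := hst i j hij α hα
    have h2 := Finset.eq_of_subset_of_card_le (rk_image_sub S i j α)
      (by rw [rk_image, h1, Finset.card_range])
    have h3 : α i - 1 ∈ Finset.range (α i) := by simp; omega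
    rw [← h2] at h3
    obtain ⟨β, hβ, hβi⟩ := Finset.mem_image.1 h3
    rw [Finset.mem_filter] at hβ
    have : α - Finsupp.single i 1 + Finsupp.single j 1 = β := by
      apply mergeExp_inj (i := i) (j := j)
      · rw [hβ.2.1]
        have hle : Finsupp.single i 1 ≤ α := by
          rw [Finsupp.single_le_iff]; omega
        obtain ⟨γ, rfl⟩ := exists_add_of_le hle
        rw [add_tsub_cancel_left, mergeExp_add, mergeExp_add]
        simp [mergeExp, hij.ne, add_comm,
          Finsupp.single_eq_of_ne hij.ne]
      · simp [hβi, Finsupp.single_eq_of_ne hij.ne]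
    rw [this]; exact hβ.1
  · push Not at hst
    obtain ⟨i, j, hij, α, hα, hne⟩ := hst
    have hlt : ∑ β ∈ S.image (cmap S i j), wt β < w := by
      rw [Finset.sum_image (cmap_injOn S hij.ne), ← hw]
      apply Finset.sum_lt_sum
      · intro β hβ
        rw [← wt_move hij (rk_le S i j β)]
        exact Nat.le_add_right _ _
      · refine ⟨α, hα, ?_⟩
        rw [← wt_move hij (rk_le S i j α)]
        have := rk_le S i j α
        have h5 := Fin.lt_def.1 hij
        exact Nat.lt_add_of_pos_right (Nat.mul_pos (by omega) (by omega))
    obtain ⟨T, h1, h2⟩ := ih _ hlt (S.image (cmap S i j)) rfl (by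
      intro β hβ
      obtain ⟨γ, hγ, rfl⟩ := Finset.mem_image.1 hβ
      rw [cmap, degree_move (rk_le S i j γ)]; exact hd γ hγ)
      ((compress_add_card S hij.ne).trans hM)
    exact ⟨T, h1.trans (Finset.card_image_of_injOn (cmap_injOn S hij.ne)), h2⟩

end Comb

section Alg
variable {n : ℕ}

lemma formSpace_fd (n d : ℕ) : FiniteDimensional ℂ (formSpace n d) := by
  have hfin : {α : Fin n →₀ ℕ | α.degree = d}.Finite := by
    exact (Finsupp.finite_of_degree_le d).subset (fun α h => le_of_eq h)
  have hle : formSpace n d ≤ Submodule.span ℂ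
      ((fun α => (monomial α (1 : ℂ) : PolyR n)) '' {α : Fin n →₀ ℕ | α.degree = d}) := by
    intro p hp
    rw [p.as_sum]
    refine Submodule.sum_mem _ fun α hα => ?_
    have : monomial α (coeff α p) = coeff α p • (monomial α (1 : ℂ) : PolyR n) := by
      simp [smul_monomial]
    rw [this]
    refine Submodule.smul_mem _ _ (Submodule.subset_span ⟨α, ?_, rfl⟩)
    have h := (mem_homogeneousSubmodule d p).1 hp (mem_support_iff.1 hα)
    rwa [Finsupp.degree_eq_weight_one]
  haveI := FiniteDimensional.span_of_finite ℂ (hfin.image fun α => (monomial α (1 : ℂ) : PolyR n))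
  exact Submodule.finiteDimensional_of_le hle

/-- leading exponents -/
noncomputable def leadSet (U : Submodule ℂ (PolyR n)) : Set (Fin n →₀ ℕ) :=
  {α | ∃ f ∈ U, f ≠ 0 ∧ MonomialOrder.lex.degree f = α}

lemma card_le_of_lead {U : Submodule ℂ (PolyR n)} [FiniteDimensional ℂ U]
    (T : Finset (Fin n →₀ ℕ)) (hT : ∀ α ∈ T, α ∈ leadSet U) : T.card ≤ finrank ℂ U := by
  classical
  choose! f hfU hf0 hfd using hT
  have hli : LinearIndependent ℂ (fun α : T => (⟨f α, hfU α α.2⟩ : U)) := by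
    rw [Fintype.linearIndependent_iff]
    intro c hc
    by_contra hne
    push Not at hne
    have hnon : (Finset.univ.filter fun α : T => c α ≠ 0).Nonempty := by
      obtain ⟨a, ha⟩ := hne
      exact ⟨a, by simp [ha]⟩
    obtain ⟨a, ha, hmax⟩ := Finset.exists_max_image _
      (fun α : T => MonomialOrder.lex.toSyn (α : Fin n →₀ ℕ)) hnon
    simp only [Finset.mem_filter, Finset.mem_univ, true_and] at ha hmax
    have h1 : ∑ α : T, c α • f α = 0 := by
      have := congrArg (Submodule.subtype U) hc
      simpa using this
    have h2 := congrArg (coeff (a : Fin n →₀ ℕ)) h1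
    rw [coeff_sum, Finset.sum_eq_single a] at h2
    · rw [coeff_smul, coeff_zero, smul_eq_mul] at h2
      have h3 : coeff (a : Fin n →₀ ℕ) (f a) ≠ 0 := by
        have := MonomialOrder.lex.coeff_degree_ne_zero_iff.2 (hf0 a a.2)
        rwa [hfd a a.2] at this
      exact (mul_ne_zero ha h3) h2
    · intro b _ hba
      by_cases hcb : c b = 0
      · simp [hcb]
      · rw [coeff_smul, MonomialOrder.lex.coeff_eq_zero_of_lt, smul_zero]
        rw [hfd b b.2]
        refine lt_of_le_of_ne (hmax b hcb) fun h => hba ?_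
        exact Subtype.ext (MonomialOrder.lex.toSyn.injective h)
    · simp
  simpa using hli.fintype_card_le_finrank

lemma leadSet_finite (U : Submodule ℂ (PolyR n)) [FiniteDimensional ℂ U] :
    (leadSet U).Finite := by
  by_contra h
  obtain ⟨T, hT, hc⟩ := Set.Infinite.exists_subset_card_eq h (finrank ℂ U + 1)
  have := card_le_of_lead (U := U) T (fun α hα => hT hα)
  omega

lemma finrank_le_lead {U : Submodule ℂ (PolyR n)}
    (T : Finset (Fin n →₀ ℕ)) (hT : ∀ α ∈ leadSet U, α ∈ T) : finrank ℂ U ≤ T.card := by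
  let φ : U →ₗ[ℂ] (T → ℂ) := LinearMap.pi fun α => (lcoeff ℂ (α : Fin n →₀ ℕ)).comp U.subtype
  have hφ : Function.Injective φ := by
    rw [injective_iff_map_eq_zero]
    intro f hf
    by_contra hne
    have h0 : (f : PolyR n) ≠ 0 := fun h => hne (Subtype.ext h)
    have hm := hT _ ⟨f, f.2, h0, rfl⟩
    have h1 := congrFun hf ⟨_, hm⟩
    exact MonomialOrder.lex.coeff_degree_ne_zero_iff.2 h0 h1
  simpa using LinearMap.finrank_le_finrank_of_injective hφ

lemma exists_lead {d : ℕ} {U : Submodule ℂ (PolyR n)} (hU : U ≤ formSpace n d) :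
    ∃ S : Finset (Fin n →₀ ℕ), S.card = finrank ℂ U ∧ (∀ α ∈ S, α.degree = d) ∧
      (S + S).card ≤ finrank ℂ ↥(U * U) := by
  haveI := formSpace_fd n d
  haveI : FiniteDimensional ℂ U := Submodule.finiteDimensional_of_le hU
  haveI : FiniteDimensional ℂ ↥(U * U) :=
    Module.Finite.iff_fg.2 ((Module.Finite.iff_fg.1 ‹FiniteDimensional ℂ U›).mul
      (Module.Finite.iff_fg.1 ‹FiniteDimensional ℂ U›))
  have hm : ∀ α, α ∈ (leadSet_finite U).toFinset ↔ α ∈ leadSet U := fun α => by simp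
  refine ⟨(leadSet_finite U).toFinset, le_antisymm ?_ ?_, ?_, ?_⟩
  · exact card_le_of_lead _ fun α h => (hm α).1 h
  · exact finrank_le_lead _ fun α h => (hm α).2 h
  · intro α hα
    obtain ⟨f, hf, h0, rfl⟩ := (hm α).1 hα
    have h := (mem_homogeneousSubmodule d f).1 (hU hf)
      (MonomialOrder.lex.coeff_degree_ne_zero_iff.2 h0)
    rwa [Finsupp.degree_eq_weight_one]
  · apply card_le_of_lead
    intro γ hγ
    obtain ⟨a, ha, b, hb, rfl⟩ := Finset.mem_add.1 hγ
    obtain ⟨f, hf, hf0, rfl⟩ := (hm a).1 ha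
    obtain ⟨g, hg, hg0, rfl⟩ := (hm b).1 hb
    exact ⟨f * g, Submodule.mul_mem_mul hf hg, mul_ne_zero hf0 hg0,
      MonomialOrder.lex.degree_mul hf0 hg0⟩

/-- span of the monomials with exponents in `S` -/
noncomputable def mspan (S : Set (Fin n →₀ ℕ)) : Submodule ℂ (PolyR n) :=
  Submodule.span ℂ ((fun α => (monomial α (1 : ℂ) : PolyR n)) '' S)

lemma finrank_mspan (S : Finset (Fin n →₀ ℕ)) :
    finrank ℂ (mspan (S : Set (Fin n →₀ ℕ))) = S.card := by
  classical
  have hli : LinearIndependent ℂ (fun α : Fin n →₀ ℕ => (monomial α (1 : ℂ) : PolyR n)) := by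
    have := (basisMonomials (Fin n) ℂ).linearIndependent
    simpa using this
  have h2 := hli.comp (fun α : S => (α : Fin n →₀ ℕ)) Subtype.val_injective
  have h3 := finrank_span_eq_card h2
  rw [Fintype.card_coe] at h3
  rw [← h3, mspan, Set.image_eq_range]
  rfl

lemma mspan_mul (S : Finset (Fin n →₀ ℕ)) :
    mspan (S : Set (Fin n →₀ ℕ)) * mspan (S : Set (Fin n →₀ ℕ))
      = mspan ((S + S : Finset (Fin n →₀ ℕ)) : Set (Fin n →₀ ℕ)) := by
  rw [mspan, mspan, Submodule.span_mul_span, Finset.coe_add]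
  congr 1
  ext p
  simp only [Set.mem_mul, Set.mem_image, Set.mem_add]
  constructor
  · rintro ⟨_, ⟨a, ha, rfl⟩, _, ⟨b, hb, rfl⟩, rfl⟩
    exact ⟨a + b, ⟨a, ha, b, hb, rfl⟩, by simp [monomial_mul]⟩
  · rintro ⟨_, ⟨a, ha, b, hb, rfl⟩, rfl⟩
    exact ⟨_, ⟨a, ha, rfl⟩, _, ⟨b, hb, rfl⟩, by simp [monomial_mul]⟩

lemma mspan_le {d : ℕ} {S : Finset (Fin n →₀ ℕ)} (hS : ∀ α ∈ S, α.degree = d) :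
    mspan (S : Set (Fin n →₀ ℕ)) ≤ formSpace n d := by
  rw [mspan, Submodule.span_le]
  rintro _ ⟨α, hα, rfl⟩
  exact (mem_homogeneousSubmodule d _).2 (isHomogeneous_monomial _ (hS α hα))

lemma mem_mspan {S : Set (Fin n →₀ ℕ)} {α : Fin n →₀ ℕ}
    (h : (monomial α (1 : ℂ) : PolyR n) ∈ mspan S) : α ∈ S := by
  by_contra hα
  have hle : mspan S ≤ LinearMap.ker (lcoeff ℂ α) := by
    rw [mspan, Submodule.span_le]
    rintro _ ⟨β, hβ, rfl⟩
    have : β ≠ α := fun e => hα (e ▸ hβ)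
    simp [coeff_monomial, this]
  have := hle h
  simp at this

end Alg

theorem stmt1 (n d k : ℕ) (hn : 2 ≤ n) (hd : 2 ≤ d) (hk : 1 ≤ k)
    (hk' : k ≤ finrank ℂ (formSpace n d)) :
    ∃ U : Submodule ℂ (PolyR n), U ≤ formSpace n d ∧ IsStronglyStable n U ∧
      vcodim n d U = k ∧ vcodim n (2 * d) (U * U) = mMax n d k := by
  haveI := formSpace_fd n d
  have hbdd : BddAbove { s | ∃ U : Submodule ℂ (PolyR n),
      U ≤ formSpace n d ∧ vcodim n d U = k ∧ vcodim n (2 * d) (U * U) = s } := by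
    refine ⟨finrank ℂ (formSpace n (2 * d)), ?_⟩
    rintro s ⟨U, -, -, rfl⟩
    exact Nat.sub_le _ _
  have hne : { s | ∃ U : Submodule ℂ (PolyR n),
      U ≤ formSpace n d ∧ vcodim n d U = k ∧ vcodim n (2 * d) (U * U) = s }.Nonempty := by
    obtain ⟨S, hS, hSd, -⟩ := exists_lead (le_refl (formSpace n d))
    obtain ⟨T, hTS, hT⟩ := Finset.exists_subset_card_eq
      (show finrank ℂ (formSpace n d) - k ≤ S.card by omega)
    refine ⟨_, mspan (T : Set (Fin n →₀ ℕ)), mspan_le fun α h => hSd α (hTS h), ?_, rfl⟩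
    rw [vcodim, finrank_mspan, hT]
    omega
  obtain ⟨U, hU, hUk, hUm⟩ := Nat.sSup_mem hne hbdd
  obtain ⟨S, hSc, hSd, hSS⟩ := exists_lead hU
  obtain ⟨T, hTc, hTd, hTT, hst⟩ := exists_stable d _ _ S rfl hSd hSS
  have hTk : vcodim n d (mspan (T : Set (Fin n →₀ ℕ))) = k := by
    rw [vcodim, finrank_mspan, hTc, hSc]; exact hUk
  refine ⟨mspan (T : Set (Fin n →₀ ℕ)), mspan_le hTd, ⟨⟨T, rfl⟩, ?_⟩, hTk, le_antisymm ?_ ?_⟩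
  · intro α hα i j hij hne
    exact Submodule.subset_span ⟨_, hst α (mem_mspan hα) i j hij hne, rfl⟩
  · exact le_csSup hbdd ⟨_, mspan_le hTd, hTk, rfl⟩
  · rw [mMax, ← hUm, vcodim, vcodim, mspan_mul, finrank_mspan]
    omega
end

section
/- Let n = 4 and d = 2, and let U ⊆ ℂ[x₁,x₂,x₃,x₄]_2 be any linear subspace of codimension 2 (so dim U = 8). Then dim U² ≤ 34, which is strictly less than 35 = min{dim A_4, dim S²U}. -/
open MvPolynomial Module

noncomputable section
namespace S2

abbrev M4 := Fin 4 → Fin 4 → ℂ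
abbrev Idx := Fin 6 ⊕ Fin 2

def I6 : Fin 6 → Fin 4 := ![0, 2, 0, 1, 0, 1]
def J6 : Fin 6 → Fin 4 := ![1, 3, 2, 3, 3, 2]

/-- The eight generators: six products of the linear forms `w`, two free quadrics. -/
def gen (w : M4) (R : Fin 2 → M4) : Idx → M4
  | .inl a => fun k l => w (I6 a) k * w (J6 a) l
  | .inr b => R b

abbrev Src := M4 × (Fin 2 → M4) × (Idx → Idx → ℂ) × (Idx → M4)

def Psi (e : Src) : Idx → M4 := fun a k l =>
  ∑ b, e.2.2.1 a b * gen e.1 e.2.1 b k l + (e.2.2.2 a k l - e.2.2.2 a l k)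

def dia : Fin 2 → M4 := fun b k l => if k = l then (![1, (k.1 : ℂ)] : Fin 2 → ℂ) b else 0

def del : M4 := fun k l => if k = l then 1 else 0

def base : Src := (del, dia, (fun a b => if a = b then 1 else 0), 0)

def dgen (w : M4) (v : M4) (Rd : Fin 2 → M4) : Idx → M4
  | .inl a => fun k l => v (I6 a) k * w (J6 a) l + w (I6 a) k * v (J6 a) l
  | .inr b => Rd b

lemma psi_contDiff : ContDiff ℂ 1 Psi := by
  unfold Psi
  rw [contDiff_pi]; intro a
  rw [contDiff_pi]; intro k
  rw [contDiff_pi]; intro l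
  simp only [Fintype.sum_sum_type, gen]
  fun_prop

lemma gen_line (w v : M4) (R Rd : Fin 2 → M4) (b : Idx) (k l : Fin 4) :
    HasDerivAt (fun t : ℂ => gen (w + t • v) (R + t • Rd) b k l) (dgen w v Rd b k l) 0 := by
  have key : ∀ x y : ℂ, HasDerivAt (fun t : ℂ => x + t * y) y 0 := by
    intro x y
    simpa using ((hasDerivAt_id (0:ℂ)).mul_const y).const_add x
  rcases b with a | b
  · have := (key (w (I6 a) k) (v (I6 a) k)).fun_mul (key (w (J6 a) l) (v (J6 a) l))
    simpa [gen, dgen] using this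
  · simpa [gen, dgen] using key (R b k l) (Rd b k l)

lemma psi_line (e v : Src) :
    HasDerivAt (fun t : ℂ => Psi (e + t • v))
      (fun a k l => ∑ b, (v.2.2.1 a b * gen e.1 e.2.1 b k l
          + e.2.2.1 a b * dgen e.1 v.1 v.2.1 b k l)
        + (v.2.2.2 a k l - v.2.2.2 a l k)) 0 := by
  have key : ∀ x y : ℂ, HasDerivAt (fun t : ℂ => x + t * y) y 0 := by
    intro x y
    simpa using ((hasDerivAt_id (0:ℂ)).mul_const y).const_add x
  rw [hasDerivAt_pi]; intro a
  rw [hasDerivAt_pi]; intro k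
  rw [hasDerivAt_pi]; intro l
  unfold Psi
  refine HasDerivAt.add ?_ ?_
  · refine HasDerivAt.fun_sum fun b _ => ?_
    have := (key (e.2.2.1 a b) (v.2.2.1 a b)).fun_mul (gen_line e.1 v.1 e.2.1 v.2.1 b k l)
    simpa using this
  · exact (key (e.2.2.2 a k l) (v.2.2.2 a k l)).sub (key (e.2.2.2 a l k) (v.2.2.2 a l k))

/-- Linear algebra of the derivative at the base point. -/
lemma dpsi_surj (y : Idx → M4) : ∃ v : Src, ∀ a k l,
    ∑ b, (v.2.2.1 a b * gen del dia b k l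
          + (if a = b then 1 else 0) * dgen del v.1 v.2.1 b k l)
        + (v.2.2.2 a k l - v.2.2.2 a l k) = y a k l := by
  -- coefficients of the two diagonal quadrics
  have h1 : ∀ a : Fin 6, ∃ p q : ℂ, ∀ k, k ≠ I6 a → k ≠ J6 a →
      p + q * (k.1 : ℂ) = y (.inl a) k k := by
    intro a
    have solve : ∀ m n : Fin 4, m ≠ n → ∃ p q : ℂ,
        p + q * (m.1 : ℂ) = y (.inl a) m m ∧ p + q * (n.1 : ℂ) = y (.inl a) n n := by
      intro m n hmn
      have hd : (n.1 : ℂ) - m.1 ≠ 0 := by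
        rw [sub_ne_zero]; intro h; exact hmn (Fin.ext (by exact_mod_cast h.symm))
      refine ⟨y (.inl a) m m - (y (.inl a) n n - y (.inl a) m m) / ((n.1 : ℂ) - m.1) * m.1,
        (y (.inl a) n n - y (.inl a) m m) / ((n.1 : ℂ) - m.1), by ring, ?_⟩
      field_simp
      ring
    have hc : ∃ m n : Fin 4, m ≠ n ∧ ∀ k, k ≠ I6 a → k ≠ J6 a → k = m ∨ k = n := by
      clear solve; revert a; unfold I6 J6; decide
    obtain ⟨m, n, hmn, hk⟩ := hc
    obtain ⟨p, q, hp, hq⟩ := solve m n hmn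
    refine ⟨p, q, fun k h h' => ?_⟩
    rcases hk k h h' with rfl | rfl <;> assumption
  choose p q hpq using h1
  -- the variation of the linear forms
  have h2 : ∃ v : M4, ∀ a : Fin 6,
      v (J6 a) (I6 a) = y (.inl a) (I6 a) (I6 a) - (p a + q a * ((I6 a).1 : ℂ)) ∧
      v (I6 a) (J6 a) = y (.inl a) (J6 a) (J6 a) - (p a + q a * ((J6 a).1 : ℂ)) := by
    refine ⟨fun m n => ∑ a, ((if J6 a = m ∧ I6 a = n then
        y (.inl a) n n - (p a + q a * (n.1 : ℂ)) else 0) + (if I6 a = m ∧ J6 a = n then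
        y (.inl a) n n - (p a + q a * (n.1 : ℂ)) else 0)), fun a => ?_⟩
    fin_cases a <;> simp [Fin.sum_univ_succ, I6, J6]
  obtain ⟨v, hv⟩ := h2
  let z : Fin 6 → M4 := fun a k l => y (.inl a) k l - dgen del v 0 (.inl a) k l
    - (if k = l then p a + q a * (k.1 : ℂ) else 0)
  have hz : ∀ a k, z a k k = 0 := by
    intro a k
    have hij : I6 a ≠ J6 a := by revert a; unfold I6 J6; decide
    simp only [z, dgen, del, if_true]
    by_cases hi : k = I6 a
    · subst hi; simp [hij.symm, (hv a).1]
    · by_cases hj : k = J6 a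
      · subst hj; simp [hij, (hv a).2]
      · simp [Ne.symm hi, Ne.symm hj, hpq a k hi hj]
  refine ⟨(v, fun b => y (.inr b), fun a => match a with
      | .inl a => Sum.elim (fun b => z a (I6 b) (J6 b) + z a (J6 b) (I6 b)) ![p a, q a]
      | .inr _ => 0, fun a => match a with
      | .inl a => fun k l => if l < k then z a k l else 0
      | .inr _ => 0), ?_⟩
  rintro (a | a) k l
  · have e : y (.inl a) k l = z a k l + dgen del v 0 (.inl a) k l
        + (if k = l then p a + q a * (k.1 : ℂ) else 0) := by simp only [z]; ring
    rw [e]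
    simp only [Finset.sum_add_distrib, ite_mul, one_mul, zero_mul, Finset.sum_ite_eq,
      Finset.mem_univ, if_true, Fintype.sum_sum_type, Sum.elim_inl, Sum.elim_inr, gen, dgen,
      Fin.sum_univ_two, dia]
    have e2 : (∑ b : Fin 6, (z a (I6 b) (J6 b) + z a (J6 b) (I6 b)) *
        (del (I6 b) k * del (J6 b) l)) = if k < l then z a k l + z a l k else 0 := by
      fin_cases k <;> fin_cases l <;> simp [Fin.sum_univ_succ, I6, J6, del]
    rw [e2]
    rcases lt_trichotomy k l with h | h | h
    · simp [h, h.not_gt, h.ne]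
      try ring
    · subst h; simp [hz]
      try ring
    · simp [h, h.not_gt, h.ne']
      try ring
  · simp [dgen]

lemma psi_nhds : Filter.map Psi (nhds base) = nhds (Psi base) := by
  have hs := psi_contDiff.contDiffAt.hasStrictFDerivAt (x := base) one_ne_zero
  refine hs.map_nhds_eq_of_surj ?_
  rw [LinearMap.range_eq_top]
  intro y
  obtain ⟨v, hv⟩ := dpsi_surj y
  refine ⟨v, ?_⟩
  have hl : HasDerivAt (fun t : ℂ => base + t • v) v 0 := by
    simpa using ((hasDerivAt_id (0:ℂ)).smul_const v).const_add base
  have h0 : base + (0:ℂ) • v = base := by simp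
  have hf : HasFDerivAt Psi (fderiv ℂ Psi base) (base + (0:ℂ) • v) := by
    rw [h0]; exact hs.hasFDerivAt
  have h1 := hf.comp_hasDerivAt (0:ℂ) hl
  have h2 := h1.unique (psi_line base v)
  refine h2.trans ?_
  funext a k l
  exact hv a k l

/-- The quadric attached to a (not necessarily symmetric) matrix. -/
def quad : M4 →ₗ[ℂ] PolyR 4 where
  toFun P := ∑ k, ∑ l, P k l • (X k * X l : PolyR 4)
  map_add' P Q := by simp [add_smul, Finset.sum_add_distrib]
  map_smul' c P := by simp [Finset.smul_sum, mul_smul]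

lemma quad_outer (u v : Fin 4 → ℂ) :
    quad (fun k l => u k * v l) = linForm 4 u * linForm 4 v := by
  simp only [quad, linForm, LinearMap.coe_mk, AddHom.coe_mk, Finset.sum_mul_sum,
    smul_mul_smul_comm]

lemma quad_skew (K : M4) : quad (fun k l => K k l - K l k) = 0 := by
  simp only [quad, LinearMap.coe_mk, AddHom.coe_mk, sub_smul, Finset.sum_sub_distrib]
  rw [sub_eq_zero, Finset.sum_comm]
  refine Finset.sum_congr rfl fun k _ => Finset.sum_congr rfl fun l _ => ?_
  rw [mul_comm]

lemma quad_psi (e : Src) (a : Idx) :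
    quad (Psi e a) = ∑ b, e.2.2.1 a b • quad (gen e.1 e.2.1 b) := by
  have : Psi e a = ∑ b, e.2.2.1 a b • gen e.1 e.2.1 b
      + (fun k l => e.2.2.2 a k l - e.2.2.2 a l k) := by
    funext k l
    simp [Psi, Finset.sum_apply]
  rw [this, map_add, quad_skew, add_zero, map_sum]
  simp

/-- Span of all pairwise products of the quadrics attached to a tuple. -/
def prodSpan (P : Idx → M4) : Submodule ℂ (PolyR 4) :=
  Submodule.span ℂ (Set.range fun x : Idx × Idx => quad (P x.1) * quad (P x.2))

lemma prodSpan_eq (P : Idx → M4) : prodSpan P =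
    Submodule.span ℂ (Set.range fun a => quad (P a)) *
      Submodule.span ℂ (Set.range fun a => quad (P a)) := by
  rw [Submodule.span_mul_span, prodSpan]
  congr 1
  ext x
  constructor
  · rintro ⟨⟨a, b⟩, rfl⟩
    exact ⟨_, ⟨a, rfl⟩, _, ⟨b, rfl⟩, rfl⟩
  · rintro ⟨_, ⟨a, rfl⟩, _, ⟨b, rfl⟩, rfl⟩
    exact ⟨(a, b), rfl⟩

instance (P : Idx → M4) : FiniteDimensional ℂ (prodSpan P) :=
  FiniteDimensional.span_of_finite ℂ (Set.finite_range _)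

def code : Idx → ℕ := Sum.elim (fun a => a.1) (fun b => 6 + b.1)

/-- Representatives of the products, with two redundant ones left out. -/
def reps : Finset (Idx × Idx) := Finset.univ.filter fun x =>
  code x.1 ≤ code x.2 ∧ ¬ (code x.1 = 2 ∧ code x.2 = 3) ∧ ¬ (code x.1 = 4 ∧ code x.2 = 5)

lemma reps_card : reps.card = 34 := by decide

lemma reps_cases : ∀ x : Idx × Idx, x ∈ reps ∨ x.swap ∈ reps ∨
    x = (.inl 2, .inl 3) ∨ x = (.inl 3, .inl 2) ∨
    x = (.inl 4, .inl 5) ∨ x = (.inl 5, .inl 4) := by decide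

lemma reps_mem : ((.inl 0, .inl 1) : Idx × Idx) ∈ reps := by decide

lemma gen_finrank (w : M4) (R : Fin 2 → M4) : finrank ℂ (prodSpan (gen w R)) ≤ 34 := by
  classical
  let f : Idx × Idx → PolyR 4 := fun x => quad (gen w R x.1) * quad (gen w R x.2)
  have hle : prodSpan (gen w R) ≤ Submodule.span ℂ ((reps.image f : Finset (PolyR 4)) : Set (PolyR 4)) := by
    rw [prodSpan, Submodule.span_le]
    rintro _ ⟨x, rfl⟩
    have hm : ∀ z ∈ reps, f z = f x → f x ∈
        Submodule.span ℂ ((reps.image f : Finset (PolyR 4)) : Set (PolyR 4)) := by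
      intro z hz h
      rw [← h]
      exact Submodule.subset_span (Finset.mem_coe.2 (Finset.mem_image_of_mem f hz))
    show f x ∈ _
    rcases reps_cases x with h | h | h
    · exact hm x h rfl
    · exact hm _ h (mul_comm _ _)
    · refine hm _ reps_mem ?_
      rcases h with rfl | rfl | rfl | rfl <;>
      · simp only [f, gen, quad_outer, I6, J6]
        simp
        ring
  have : FiniteDimensional ℂ (Submodule.span ℂ ((reps.image f : Finset (PolyR 4)) : Set (PolyR 4))) :=
    FiniteDimensional.span_finset ℂ _
  calc finrank ℂ (prodSpan (gen w R)) ≤ _ := Submodule.finrank_mono hle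
    _ ≤ (reps.image f).card := finrank_span_finset_le_card _
    _ ≤ reps.card := Finset.card_image_le
    _ = 34 := reps_card

lemma psi_finrank (e : Src) : finrank ℂ (prodSpan (Psi e)) ≤ 34 := by
  refine le_trans (Submodule.finrank_mono ?_) (gen_finrank e.1 e.2.1)
  rw [prodSpan_eq, prodSpan_eq]
  have : Submodule.span ℂ (Set.range fun a => quad (Psi e a)) ≤
      Submodule.span ℂ (Set.range fun a => quad (gen e.1 e.2.1 a)) := by
    rw [Submodule.span_le]
    rintro _ ⟨a, rfl⟩
    show quad (Psi e a) ∈ _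
    rw [quad_psi]
    exact Submodule.sum_mem _ fun b _ => Submodule.smul_mem _ _
      (Submodule.subset_span ⟨b, rfl⟩)
  exact mul_le_mul' this this

lemma finrank_main (P : Idx → M4) : finrank ℂ (prodSpan P) ≤ 34 := by
  by_contra hcon
  push Not at hcon
  have hfin : FiniteDimensional ℂ (Submodule.span ℂ
      (Set.range fun x : Idx × Idx => quad (P x.1) * quad (P x.2))) :=
    FiniteDimensional.span_of_finite ℂ (Set.finite_range _)
  obtain ⟨N, hN, g, hg, hli⟩ : ∃ N, 34 < N ∧ ∃ g : Fin N → PolyR 4,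
      (∀ i, g i ∈ Set.range fun x : Idx × Idx => quad (P x.1) * quad (P x.2)) ∧
      LinearIndependent ℂ g := by
    obtain ⟨g, hg, -, hli⟩ := Submodule.exists_fun_fin_finrank_span_eq ℂ
      (Set.range fun x : Idx × Idx => quad (P x.1) * quad (P x.2))
    exact ⟨_, hcon, g, hg, hli⟩
  choose s hs using hg
  obtain ⟨L, hL⟩ := LinearMap.exists_leftInverse_of_injective
    (Fintype.linearCombination ℂ g) (LinearMap.ker_eq_bot.2
      hli.fintypeLinearCombination_injective)
  have hLg : ∀ i, L (g i) = Pi.single i 1 := by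
    intro i
    have := LinearMap.congr_fun hL (Pi.single i 1)
    simpa [Fintype.linearCombination_apply_single] using this
  let D : Idx → M4 := P - Psi base
  let A : ℂ → Matrix (Fin N) (Fin N) ℂ := fun t => Matrix.of fun i =>
    L (quad ((Psi base + t • D) (s i).1) * quad ((Psi base + t • D) (s i).2))
  have hA1 : A 1 = 1 := by
    ext i j
    have e1 : Psi base + (1:ℂ) • D = P := by simp [D]
    simp only [A, e1, Matrix.of_apply]
    have := hs i
    simp only at this
    rw [this, hLg, Matrix.one_apply, Pi.single_apply]
    simp [eq_comm]
  have hdiff : Differentiable ℂ fun t => (A t).det := by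
    have he : ∀ i j, Differentiable ℂ fun t => A t i j := by
      intro i j
      simp only [A, Matrix.of_apply, Pi.add_apply, Pi.smul_apply, map_add, map_smul, add_mul,
        mul_add, smul_mul_assoc, mul_smul_comm, smul_eq_mul]
      fun_prop
    simp only [Matrix.det_apply]
    fun_prop
  have hzero : ∀ᶠ t in nhds (0:ℂ), (A t).det = 0 := by
    have hc : Filter.Tendsto (fun t : ℂ => Psi base + t • D) (nhds 0) (nhds (Psi base)) := by
      have : Continuous (fun t : ℂ => Psi base + t • D) := by fun_prop
      simpa using this.tendsto 0
    have hr : Set.range Psi ∈ nhds (Psi base) := by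
      rw [← psi_nhds]; exact Filter.range_mem_map
    filter_upwards [hc hr] with t ht
    obtain ⟨e, he⟩ := ht
    by_contra hdet
    have hli2 := Matrix.linearIndependent_rows_of_det_ne_zero hdet
    have hli3 : LinearIndependent ℂ fun i =>
        quad ((Psi base + t • D) (s i).1) * quad ((Psi base + t • D) (s i).2) :=
      LinearIndependent.of_comp L hli2
    simp only [← he] at hli3
    have hli4 : LinearIndependent ℂ fun i => (⟨quad (Psi e (s i).1) * quad (Psi e (s i).2),
        Submodule.subset_span ⟨s i, rfl⟩⟩ : prodSpan (Psi e)) :=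
      LinearIndependent.of_comp (prodSpan (Psi e)).subtype hli3
    have := hli4.fintype_card_le_finrank
    have h34 := psi_finrank e
    simp only [Fintype.card_fin] at this
    omega
  have hana : AnalyticOnNhd ℂ (fun t => (A t).det) Set.univ :=
    fun t _ => hdiff.analyticAt t
  have h := congrFun (hana.eq_of_eventuallyEq (g := fun _ => (0:ℂ))
    (fun t _ => analyticAt_const) hzero) 1
  simp [hA1] at h

lemma finrank_form (d : ℕ) : finrank ℂ (formSpace 4 d) = (4 + d - 1).choose d := by
  have e : formSpace 4 d = Submodule.span ℂ
      (Set.range fun m : (Finset.univ : Finset (Fin 4)).finsuppAntidiag d =>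
        (monomial m.1 (1:ℂ) : PolyR 4)) := by
    rw [formSpace, homogeneousSubmodule_eq_finsupp_supported,
      AddMonoidAlgebra.supported_eq_span_single]
    congr 1
    ext x
    simp [Finsupp.degree_eq_sum, single_eq_monomial, Finset.mem_finsuppAntidiag]
  rw [e, finrank_span_eq_card, Fintype.card_coe, Finset.card_finsuppAntidiag_nat_eq_choose]
  · simp
  · exact ((basisMonomials (Fin 4) ℂ).linearIndependent.comp _ Subtype.val_injective)

lemma quad_surj (p : PolyR 4) (hp : p ∈ formSpace 4 2) : ∃ P, quad P = p := by
  have : formSpace 4 2 ≤ LinearMap.range quad := by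
    rw [formSpace, homogeneousSubmodule_eq_finsupp_supported,
      AddMonoidAlgebra.supported_eq_span_single, Submodule.span_le]
    rintro _ ⟨m, hm, rfl⟩
    have hX : ∃ i j : Fin 4, m = Finsupp.single i 1 + Finsupp.single j 1 := by
      have hm2 : m.degree = 2 := hm
      have hne : ∃ i, m i ≠ 0 := by
        by_contra hcon
        push Not at hcon
        have : m = 0 := Finsupp.ext hcon
        simp [this] at hm2
      obtain ⟨i, hi⟩ := hne
      have hle : Finsupp.single i 1 ≤ m := by
        rw [Finsupp.single_le_iff]; omega
      obtain ⟨m', rfl⟩ := exists_add_of_le hle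
      have hm1 : m'.degree = 1 := by
        rw [map_add, Finsupp.degree_single] at hm2; omega
      have : m' ∈ {d : Fin 4 →₀ ℕ | d.degree = 1} := hm1
      rw [← Finsupp.range_single_one] at this
      obtain ⟨j, rfl⟩ := this
      exact ⟨i, j, rfl⟩
    obtain ⟨i, j, rfl⟩ := hX
    refine ⟨fun k l => (Pi.single i 1 : Fin 4 → ℂ) k * (Pi.single j 1 : Fin 4 → ℂ) l, ?_⟩
    rw [quad_outer]
    simp [linForm, Pi.single_apply, X, monomial_mul, single_eq_monomial]
  exact this hp

end S2
end

theorem stmt2 (U : Submodule ℂ (PolyR 4)) (hU : U ≤ formSpace 4 2)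
    (hcodim : vcodim 4 2 U = 2) :
    finrank ℂ (U * U : Submodule ℂ (PolyR 4)) ≤ 34 ∧
      34 < min (finrank ℂ (formSpace 4 4))
        (finrank ℂ U * (finrank ℂ U + 1) / 2) ∧
      min (finrank ℂ (formSpace 4 4)) (finrank ℂ U * (finrank ℂ U + 1) / 2) = 35 := by
  have h2 : finrank ℂ (formSpace 4 2) = 10 := S2.finrank_form 2
  have h4 : finrank ℂ (formSpace 4 4) = 35 := S2.finrank_form 4
  have h8 : finrank ℂ U = 8 := by
    unfold vcodim at hcodim
    omega
  refine ⟨?_, by rw [h4, h8]; norm_num, by rw [h4, h8]; norm_num⟩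
  have : FiniteDimensional ℂ U := FiniteDimensional.of_finrank_pos (by omega)
  let b := (finBasisOfFinrankEq ℂ U h8).reindex (finSumFinEquiv (m := 6) (n := 2)).symm
  choose P hP using fun a => S2.quad_surj (b a : PolyR 4) (hU (b a).2)
  have hs : Submodule.span ℂ (Set.range fun a => S2.quad (P a)) = U := by
    simp only [hP]
    have := congrArg (Submodule.map U.subtype) b.span_eq
    rw [Submodule.map_span, ← Set.range_comp] at this
    rw [Submodule.map_top, Submodule.range_subtype] at this
    exact this
  have := S2.finrank_main P
  rwa [S2.prodSpan_eq, hs] at this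
end

section
/- Let U ⊆ A_d be a base-point-free linear subspace of codimension k with k ≤ d. Then dim (A/⟨U⟩)_{2d−1} ≤ 1, i.e. the span of products A_{d−1}U has codimension at most 1 in A_{2d−1}. If moreover k < d, then dim (A/⟨U⟩)_{2d−1} = 0, i.e. A_{d−1}U = A_{2d−1}. -/
open MvPolynomial Module

/-- Contraction action of polynomials on linear functionals. -/
noncomputable def actP {n : ℕ} (p : PolyR n) : Dual ℂ (PolyR n) →ₗ[ℂ] Dual ℂ (PolyR n) :=
  (LinearMap.mulLeft ℂ p).dualMap

theorem actP_apply {n : ℕ} (p q : PolyR n) (φ : Dual ℂ (PolyR n)) :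
    actP p φ q = φ (p * q) := rfl

theorem actP_mul {n : ℕ} (p q : PolyR n) (φ : Dual ℂ (PolyR n)) :
    actP (p * q) φ = actP p (actP q φ) := by
  refine LinearMap.ext fun r => ?_
  simp only [actP_apply]
  congr 1
  ring

theorem actP_comm {n : ℕ} (p q : PolyR n) (φ : Dual ℂ (PolyR n)) :
    actP p (actP q φ) = actP q (actP p φ) := by
  rw [← actP_mul, ← actP_mul, mul_comm]

theorem actP_one {n : ℕ} (φ : Dual ℂ (PolyR n)) : actP 1 φ = φ := by
  refine LinearMap.ext fun r => ?_
  simp [actP_apply]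

theorem actP_linForm {n : ℕ} (c : Fin n → ℂ) (φ : Dual ℂ (PolyR n)) :
    actP (linForm n c) φ = ∑ i, c i • actP (X i) φ := by
  refine LinearMap.ext fun r => ?_
  simp [actP_apply, linForm, Finset.sum_mul, LinearMap.sum_apply]

/-- The functional is concentrated in degree `t`. -/
noncomputable def SuppIn {n : ℕ} (t : ℕ) (φ : Dual ℂ (PolyR n)) : Prop :=
  ∀ s, s ≠ t → ∀ p : PolyR n, p.IsHomogeneous s → φ p = 0

theorem SuppIn.act {n s t : ℕ} {φ : Dual ℂ (PolyR n)} (h : SuppIn (s + t) φ)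
    {p : PolyR n} (hp : p.IsHomogeneous s) : SuppIn t (actP p φ) := by
  intro r hr q hq
  rw [actP_apply]
  exact h (s + r) (by omega) _ (hp.mul hq)

theorem SuppIn.eq_zero {n t : ℕ} {φ : Dual ℂ (PolyR n)} (h : SuppIn t φ) (ht : 1 ≤ t)
    (hX : ∀ i, actP (X i) φ = 0) : φ = 0 := by
  refine LinearMap.ext fun p => ?_
  rw [LinearMap.zero_apply]
  induction p using MvPolynomial.induction_on with
  | C a => exact h 0 (by omega) _ (isHomogeneous_C _ a)
  | add p q hp hq => rw [map_add, hp, hq, add_zero]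
  | mul_X p i _ => rw [mul_comm, ← actP_apply, hX i, LinearMap.zero_apply]

theorem linForm_hom {n : ℕ} (c : Fin n → ℂ) : (linForm n c).IsHomogeneous 1 := by
  unfold linForm
  refine IsHomogeneous.sum _ _ _ fun i _ => ?_
  rw [MvPolynomial.smul_eq_C_mul]
  simpa using (isHomogeneous_C (Fin n) (c i)).mul (isHomogeneous_X ℂ i)

/-- A linear form killing none of finitely many nonzero functionals of positive degree. -/
theorem exists_linForm {n m : ℕ} (G : Fin m → Dual ℂ (PolyR n)) (t : Fin m → ℕ)
    (hG : ∀ j, SuppIn (t j) (G j)) (ht : ∀ j, 1 ≤ t j) (h0 : ∀ j, G j ≠ 0) :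
    ∃ c : Fin n → ℂ, ∀ j, actP (linForm n c) (G j) ≠ 0 := by
  by_contra! hcon
  let L : (j : Fin m) → (Fin n → ℂ) →ₗ[ℂ] Dual ℂ (PolyR n) := fun j =>
    Fintype.linearCombination ℂ (fun i => actP (X i) (G j))
  have hL : ∀ j c, L j c = actP (linForm n c) (G j) := by
    intro j c
    rw [actP_linForm]
    rfl
  have hcov : ⋃ j, ((LinearMap.ker (L j) : Submodule ℂ (Fin n → ℂ)) : Set (Fin n → ℂ))
      = Set.univ := by
    rw [Set.eq_univ_iff_forall]
    intro c
    obtain ⟨j, hj⟩ := hcon c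
    rw [Set.mem_iUnion]
    exact ⟨j, by rw [SetLike.mem_coe, LinearMap.mem_ker, hL, hj]⟩
  obtain ⟨j, hj⟩ := Subspace.exists_eq_top_of_iUnion_eq_univ hcov
  refine h0 j ((hG j).eq_zero (ht j) fun i => ?_)
  have h1 : L j (Pi.single i 1) = 0 := by
    rw [← LinearMap.mem_ker, hj]
    trivial
  simpa [L] using h1

/-- Green-type statement: a space of at most `t` functionals of degree `t` is acted upon injectively
by some linear form. -/
theorem exists_inj {n t : ℕ} (W : Submodule ℂ (Dual ℂ (PolyR n))) [FiniteDimensional ℂ W]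
    (hW : ∀ φ ∈ W, SuppIn t φ) (hdim : finrank ℂ W ≤ t) :
    ∃ c : Fin n → ℂ, ∀ φ ∈ W, actP (linForm n c) φ = 0 → φ = 0 := by
  by_contra! hcon
  have key : ∀ m, m ≤ t + 1 → ∃ (F : ℕ → Dual ℂ (PolyR n)) (P : ℕ → PolyR n),
      ∀ j < m, F j ∈ W ∧ (P j).IsHomogeneous (m - 1 - j) ∧ actP (P j) (F j) ≠ 0 ∧
        ∀ i < m, j < i → actP (P j) (F i) = 0 := by
    intro m
    induction m with
    | zero => intro _; exact ⟨fun _ => 0, fun _ => 0, by simp⟩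
    | succ m ih =>
      intro hm
      obtain ⟨F, P, h⟩ := ih (by omega)
      obtain ⟨c, hc⟩ := exists_linForm (n := n) (m := m) (fun j => actP (P j) (F j))
        (fun j => t - (m - 1 - j))
        (fun j => by
          obtain ⟨h1, h2, _⟩ := h j j.2
          refine SuppIn.act (s := m - 1 - j) ?_ h2
          have : m - 1 - (j : ℕ) + (t - (m - 1 - j)) = t := by omega
          rw [this]
          exact hW _ h1)
        (fun j => by omega) (fun j => (h j j.2).2.2.1)
      obtain ⟨φ, hφ, hφ1, hφ0⟩ := hcon c
      refine ⟨fun j => if j < m then F j else φ,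
        fun j => if j < m then linForm n c * P j else 1, ?_⟩
      intro j hj
      by_cases hjm : j < m
      · obtain ⟨h1, h2, h3, h4⟩ := h j hjm
        simp only [hjm, if_true]
        refine ⟨h1, ?_, ?_, ?_⟩
        · have := (linForm_hom c).mul h2
          have e : 1 + (m - 1 - j) = m + 1 - 1 - j := by omega
          rwa [e] at this
        · rw [actP_mul]
          exact hc ⟨j, hjm⟩
        · intro i hi hji
          by_cases him : i < m
          · simp only [him, if_true]
            rw [actP_mul, h4 i him hji, map_zero]
          · simp only [him, if_false]
            rw [actP_mul, actP_comm, hφ1, map_zero]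
      · have : j = m := by omega
        subst this
        simp only [lt_irrefl, if_false]
        refine ⟨hφ, ?_, ?_, ?_⟩
        · simpa using isHomogeneous_one (Fin n) ℂ
        · rwa [actP_one]
        · intro i hi hji
          omega
  obtain ⟨F, P, h⟩ := key (t + 1) le_rfl
  have hli : LinearIndependent ℂ (fun j : Fin (t + 1) => (⟨F j, (h j j.2).1⟩ : W)) := by
    rw [Fintype.linearIndependent_iff]
    intro g hg
    have hg' : ∑ i : Fin (t + 1), g i • F i = 0 := by
      have := congrArg (W.subtype) hg
      simpa using this
    have : ∀ k : ℕ, ∀ hk : k < t + 1, g ⟨k, hk⟩ = 0 := by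
      intro k
      induction k using Nat.strong_induction_on with
      | _ k ih =>
        intro hk
        obtain ⟨h1, h2, h3, h4⟩ := h k hk
        have e := congrArg (actP (P k)) hg'
        rw [map_sum, map_zero, Finset.sum_eq_single ⟨k, hk⟩] at e
        · rw [map_smul] at e
          exact (smul_eq_zero.mp e).resolve_right h3
        · intro i _ hik
          rw [map_smul]
          rcases lt_trichotomy (i : ℕ) k with h5 | h5 | h5
          · rw [ih i h5 i.2, zero_smul]
          · exact absurd (Fin.ext h5) hik
          · rw [h4 i i.2 h5, smul_zero]
        · intro h6
          exact absurd (Finset.mem_univ _) h6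
    intro i
    exact this i i.2
  have := hli.fintype_card_le_finrank
  rw [Fintype.card_fin] at this
  omega

/-- Commuting endomorphisms of a nonzero complex space have a common eigenvector. -/
theorem exists_common_eigen {V : Type*} [AddCommGroup V] [Module ℂ V] [FiniteDimensional ℂ V]
    [Nontrivial V] {n : ℕ} (M : Fin n → V →ₗ[ℂ] V) (hM : ∀ i j v, M i (M j v) = M j (M i v)) :
    ∃ (c : Fin n → ℂ) (v : V), v ≠ 0 ∧ ∀ i, M i v = c i • v := by
  have key : ∀ s : Finset (Fin n), ∃ (c : Fin n → ℂ) (E : Submodule ℂ V), E ≠ ⊥ ∧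
      (∀ i, ∀ v ∈ E, M i v ∈ E) ∧ ∀ i ∈ s, ∀ v ∈ E, M i v = c i • v := by
    intro s
    induction s using Finset.induction_on with
    | empty => exact ⟨0, ⊤, top_ne_bot, by simp, by simp⟩
    | insert a s ha ih =>
      obtain ⟨c, E, hE, hinv, heig⟩ := ih
      have : Nontrivial E := (Submodule.nontrivial_iff_ne_bot).mpr hE
      obtain ⟨μ, hμ⟩ := Module.End.exists_eigenvalue ((M a).restrict (hinv a))
      obtain ⟨v, hv⟩ := hμ.exists_hasEigenvector
      have hv1 : M a (v : V) = μ • (v : V) := by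
        have := congrArg Subtype.val hv.apply_eq_smul
        simpa using this
      have hv0 : (v : V) ≠ 0 := by
        intro h
        exact hv.2 (Subtype.ext h)
      refine ⟨Function.update c a μ, E ⊓ LinearMap.ker (M a - μ • LinearMap.id), ?_, ?_, ?_⟩
      · intro hb
        apply hv0
        have : (v : V) ∈ E ⊓ LinearMap.ker (M a - μ • LinearMap.id) :=
          ⟨v.2, by simp [hv1]⟩
        rw [hb] at this
        simpa using this
      · rintro i w ⟨hw, hw2⟩
        refine ⟨hinv i w hw, ?_⟩
        simp only [SetLike.mem_coe, LinearMap.mem_ker, LinearMap.sub_apply, LinearMap.smul_apply,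
          LinearMap.id_apply, sub_eq_zero] at hw2 ⊢
        rw [hM, hw2, map_smul]
      · rintro i hi w ⟨hw, hw2⟩
        simp only [SetLike.mem_coe, LinearMap.mem_ker, LinearMap.sub_apply, LinearMap.smul_apply,
          LinearMap.id_apply, sub_eq_zero] at hw2
        by_cases hia : i = a
        · subst hia
          simpa using hw2
        · rw [Function.update_of_ne hia]
          exact heig i ((Finset.mem_insert.mp hi).resolve_left hia) w hw
  obtain ⟨c, E, hE, -, h⟩ := key Finset.univ
  obtain ⟨v, hv, hv0⟩ := Submodule.exists_mem_ne_zero_of_ne_bot hE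
  exact ⟨c, v, hv0, fun i => h i (Finset.mem_univ i) v hv⟩

/-- Gotzmann-type statement. Either the dimension drops, or there is a point functional. -/
theorem drop_or_point {n t : ℕ} (ht : 1 ≤ t) (W W' : Submodule ℂ (Dual ℂ (PolyR n)))
    [FiniteDimensional ℂ W] [FiniteDimensional ℂ W']
    (hW : ∀ φ ∈ W, SuppIn t φ) (hW' : ∀ φ ∈ W', SuppIn (1 + t) φ)
    (hX : ∀ i, ∀ φ ∈ W', actP (X i) φ ∈ W) (hdim : finrank ℂ W ≤ t) :
    finrank ℂ W' ≤ finrank ℂ W - 1 ∨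
    ∃ (x c : Fin n → ℂ), ∃ φ ∈ W, φ ≠ 0 ∧
      ∀ i, actP (X i) φ = x i • actP (linForm n c) φ := by
  obtain ⟨c, hc⟩ := exists_inj W hW hdim
  have hl : ∀ φ ∈ W', actP (linForm n c) φ ∈ W := by
    intro φ hφ
    rw [actP_linForm]
    exact W.sum_mem fun i _ => W.smul_mem _ (hX i φ hφ)
  have hc' : ∀ φ ∈ W', actP (linForm n c) φ = 0 → φ = 0 := by
    intro φ hφ h
    refine (hW' φ hφ).eq_zero (by omega) fun i => hc _ (hX i φ hφ) ?_
    rw [actP_comm, h, map_zero]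
  let L : W' →ₗ[ℂ] W := (actP (linForm n c)).restrict hl
  have hLinj : Function.Injective L := by
    rw [← LinearMap.ker_eq_bot, LinearMap.ker_eq_bot']
    intro φ h
    exact Subtype.ext (hc' φ φ.2 (congrArg Subtype.val h))
  have hle := LinearMap.finrank_le_finrank_of_injective hLinj
  rcases Nat.eq_zero_or_pos (finrank ℂ W) with h0 | h0
  · left; omega
  rcases Nat.lt_or_ge (finrank ℂ W') (finrank ℂ W) with h1 | h1
  · left; omega
  right
  have heq : finrank ℂ W' = finrank ℂ W := le_antisymm hle h1
  have : Nontrivial W := Module.finrank_pos_iff.mp h0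
  let e : W' ≃ₗ[ℂ] W := LinearMap.linearEquivOfInjective L hLinj heq
  have he : ∀ φ : W, actP (linForm n c) (e.symm φ : Dual ℂ (PolyR n)) = φ := by
    intro φ
    exact congrArg Subtype.val (e.apply_symm_apply φ)
  let M : Fin n → W →ₗ[ℂ] W := fun i => ((actP (X i)).restrict (hX i)) ∘ₗ e.symm.toLinearMap
  have hMv : ∀ i φ, (M i φ : Dual ℂ (PolyR n)) = actP (X i) (e.symm φ : Dual ℂ (PolyR n)) :=
    fun i φ => rfl
  have hlM : ∀ i (φ : W), actP (linForm n c) (M i φ : Dual ℂ (PolyR n)) = actP (X i) φ := by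
    intro i φ
    rw [hMv, actP_comm, he]
  have hcomm : ∀ i j v, M i (M j v) = M j (M i v) := by
    intro i j v
    rw [← sub_eq_zero]
    apply Subtype.ext
    apply hc _ (M i (M j v) - M j (M i v)).2
    rw [Submodule.coe_sub, map_sub, hlM, hlM, hMv, hMv, actP_comm, sub_self]
  obtain ⟨x, v, hv0, hv⟩ := exists_common_eigen M hcomm
  refine ⟨x, c, v, v.2, fun h => hv0 (Subtype.ext h), fun i => ?_⟩
  rw [← hlM, hv, Submodule.coe_smul, map_smul]

theorem act_point {n : ℕ} {x c : Fin n → ℂ} {φ : Dual ℂ (PolyR n)}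
    (h : ∀ i, actP (X i) φ = x i • actP (linForm n c) φ) (p : PolyR n) (s : ℕ)
    (hp : p.IsHomogeneous s) : φ p = eval x p * φ (linForm n c ^ s) := by
  have gen : ∀ (m : Fin n →₀ ℕ) (q : PolyR n), φ (monomial m 1 * q) =
      eval x (monomial m (1 : ℂ)) * φ (linForm n c ^ m.degree * q) := by
    intro m
    induction m using Finsupp.induction_linear with
    | zero => intro q; simp
    | add m m' hm hm' =>
      intro q
      have e : (monomial (m + m') (1 : ℂ) : PolyR n) = monomial m 1 * monomial m' 1 := by
        rw [monomial_mul, one_mul]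
      have e1 : linForm n c ^ m.degree * (monomial m' (1 : ℂ) * q) =
          monomial m' (1 : ℂ) * (linForm n c ^ m.degree * q) := by ring
      have e2 : linForm n c ^ m'.degree * (linForm n c ^ m.degree * q) =
          linForm n c ^ (m + m').degree * q := by
        rw [map_add, pow_add]; ring
      rw [e, mul_assoc, hm, e1, hm', e2, map_mul (eval x), mul_assoc]
    | single i k =>
      rw [← X_pow_eq_monomial, Finsupp.degree_single]
      induction k with
      | zero => intro q; simp
      | succ k ih =>
        intro q
        have e0 : ∀ r, φ (X i * r) = x i * φ (linForm n c * r) := by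
          intro r
          have := LinearMap.congr_fun (h i) r
          simpa [actP_apply] using this
        have e1 : (X i ^ (k + 1) * q : PolyR n) = X i ^ k * (X i * q) := by ring
        have e2 : linForm n c ^ k * (X i * q) = X i * (linForm n c ^ k * q) := by ring
        have e3 : linForm n c * (linForm n c ^ k * q) = linForm n c ^ (k + 1) * q := by ring
        rw [e1, ih, e2, e0, e3]
        simp only [map_pow, eval_X]
        ring
  have hm : ∀ m ∈ p.support, φ (monomial m (coeff m p)) =
      eval x (monomial m (coeff m p)) * φ (linForm n c ^ s) := by
    intro m hm
    have hdeg : m.degree = s := by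
      rw [Finsupp.degree_eq_weight_one]
      exact hp (mem_support_iff.mp hm)
    have e := gen m 1
    rw [mul_one, mul_one, hdeg] at e
    have e1 : (monomial m (coeff m p) : PolyR n) = coeff m p • monomial m 1 := by
      rw [smul_monomial, smul_eq_mul, mul_one]
    rw [e1, map_smul, e, smul_eval, smul_eq_mul, mul_assoc]
  conv_lhs => rw [p.as_sum]
  rw [map_sum, Finset.sum_congr rfl hm, ← Finset.sum_mul, ← map_sum, ← p.as_sum]

/-- The dual of the degree `t` part of `A / I`. -/
noncomputable def dualW (n t : ℕ) (I : Submodule ℂ (PolyR n)) : Submodule ℂ (Dual ℂ (PolyR n)) :=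
  (I.comap (homogeneousComponent t)).dualAnnihilator

theorem mem_dualW {n t : ℕ} {I : Submodule ℂ (PolyR n)} {φ : Dual ℂ (PolyR n)} :
    φ ∈ dualW n t I ↔ ∀ p, homogeneousComponent t p ∈ I → φ p = 0 := by
  simp [dualW, Submodule.mem_dualAnnihilator]

theorem dualW_supp {n t : ℕ} {I : Submodule ℂ (PolyR n)} {φ : Dual ℂ (PolyR n)}
    (h : φ ∈ dualW n t I) : SuppIn t φ := by
  intro s hs p hp
  apply mem_dualW.mp h
  rw [homogeneousComponent_of_mem hp, if_neg (by omega)]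
  exact I.zero_mem

theorem homComp_X_mul {n t : ℕ} (i : Fin n) (p : PolyR n) :
    homogeneousComponent (t + 1) (X i * p) = X i * homogeneousComponent t p := by
  conv_lhs => rw [← sum_homogeneousComponent p]
  rw [Finset.mul_sum, map_sum]
  have : ∀ s, homogeneousComponent (t + 1) (X i * homogeneousComponent s p) =
      if s = t then X i * homogeneousComponent t p else 0 := by
    intro s
    have h := (isHomogeneous_X ℂ i).mul (homogeneousComponent_isHomogeneous s p)
    rw [homogeneousComponent_of_mem h]
    by_cases hs : s = t
    · subst hs
      rw [if_pos (by omega), if_pos rfl]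
    · rw [if_neg (by omega), if_neg hs]
  simp only [this, Finset.sum_ite_eq', Finset.mem_range]
  split_ifs with h
  · rfl
  · rw [homogeneousComponent_eq_zero _ _ (by omega), mul_zero]

instance formSpace_fin (n d : ℕ) : FiniteDimensional ℂ (formSpace n d) :=
  Module.Finite.iff_fg.mpr (homogeneousSubmodule_fg (Fin n) ℂ d)

theorem dualW_dim (n t : ℕ) (I : Submodule ℂ (PolyR n)) (hI : I ≤ formSpace n t) :
    FiniteDimensional ℂ (dualW n t I) ∧ finrank ℂ (dualW n t I) = vcodim n t I := by
  let K := I.comap (homogeneousComponent (R := ℂ) (σ := Fin n) t)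
  let J : Submodule ℂ (formSpace n t) := I.comap (formSpace n t).subtype
  let f : PolyR n →ₗ[ℂ] formSpace n t :=
    (homogeneousComponent t).codRestrict (formSpace n t)
      (fun p => homogeneousComponent_isHomogeneous t p)
  let g : PolyR n →ₗ[ℂ] (formSpace n t ⧸ J) := J.mkQ ∘ₗ f
  have hker : LinearMap.ker g = K := by
    ext p
    simp only [g, K, J, LinearMap.mem_ker, LinearMap.comp_apply, Submodule.mkQ_apply,
      Submodule.Quotient.mk_eq_zero, Submodule.mem_comap]
    rfl
  have hsurj : Function.Surjective g := by
    refine (Submodule.mkQ_surjective J).comp fun p => ⟨p, Subtype.ext ?_⟩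
    exact homogeneousComponent_eq_self p.2
  let e : (PolyR n ⧸ K) ≃ₗ[ℂ] (formSpace n t ⧸ J) :=
    (Submodule.quotEquivOfEq _ _ hker.symm).trans (g.quotKerEquivOfSurjective hsurj)
  have hfin : FiniteDimensional ℂ (PolyR n ⧸ K) := e.symm.finiteDimensional
  have eW : Dual ℂ (PolyR n ⧸ K) ≃ₗ[ℂ] dualW n t I := Submodule.dualQuotEquivDualAnnihilator K
  refine ⟨eW.finiteDimensional, ?_⟩
  rw [← eW.finrank_eq, Subspace.dual_finrank_eq, e.finrank_eq]
  have h1 := Submodule.finrank_quotient_add_finrank J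
  have h2 : finrank ℂ J = finrank ℂ I := (Submodule.comapSubtypeEquivOfLe hI).finrank_eq
  unfold vcodim
  omega

theorem step {n d : ℕ} (hd : 1 ≤ d) (U : Submodule ℂ (PolyR n)) (hU : U ≤ formSpace n d)
    (hbpf : IsBPF n U) (j : ℕ) (hk : vcodim n (d + j) (formSpace n j * U) ≤ d + j) :
    vcodim n (d + (j + 1)) (formSpace n (j + 1) * U) ≤
      vcodim n (d + j) (formSpace n j * U) - 1 := by
  have hle : ∀ j, formSpace n j * U ≤ formSpace n (d + j) := by
    intro j
    rw [add_comm]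
    exact (mul_le_mul' le_rfl hU).trans (homogeneousSubmodule_mul j d)
  obtain ⟨f1, e1⟩ := dualW_dim n (d + j) _ (hle j)
  obtain ⟨f2, e2⟩ := dualW_dim n (d + (j + 1)) _ (hle (j + 1))
  rw [← e1] at hk ⊢
  rw [← e2]
  rcases drop_or_point (t := d + j) (by omega) (dualW n (d + j) (formSpace n j * U))
    (dualW n (d + (j + 1)) (formSpace n (j + 1) * U)) (fun φ h => dualW_supp h)
    (fun φ h => by
      have := dualW_supp h
      have e : d + (j + 1) = 1 + (d + j) := by omega
      rwa [e] at this) (fun i φ h => by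
      rw [mem_dualW] at h ⊢
      intro p hp
      rw [actP_apply]
      apply h
      rw [← add_assoc, homComp_X_mul]
      have hsub : formSpace n 1 * (formSpace n j * U) ≤ formSpace n (j + 1) * U := by
        rw [← mul_assoc, add_comm]
        exact mul_le_mul' (homogeneousSubmodule_mul 1 j) le_rfl
      exact hsub (Submodule.mul_mem_mul (isHomogeneous_X ℂ i) hp)) hk with h | ⟨x, c, φ, hφ, hφ0, h⟩
  · exact h
  · exfalso
    have hx : x ≠ 0 := by
      rintro rfl
      refine hφ0 ((dualW_supp hφ).eq_zero (by omega) fun i => ?_)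
      rw [h]
      simp
    apply hx
    apply hbpf
    intro q hq
    have hne : φ (linForm n c ^ (d + j)) ≠ 0 := by
      intro h0
      apply hφ0
      refine LinearMap.ext fun p => ?_
      conv_lhs => rw [← sum_homogeneousComponent p]
      rw [map_sum, LinearMap.zero_apply]
      refine Finset.sum_eq_zero fun s _ => ?_
      by_cases hs : s = d + j
      · rw [act_point h _ s (homogeneousComponent_isHomogeneous s p), hs, h0, mul_zero]
      · exact dualW_supp hφ s hs _ (homogeneousComponent_isHomogeneous s p)
    obtain ⟨i, hi⟩ := Function.ne_iff.mp hx
    have hXj : (X i ^ j : PolyR n).IsHomogeneous j := by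
      simpa using (isHomogeneous_X ℂ i).pow j
    have hpq : (X i ^ j * q : PolyR n).IsHomogeneous (d + j) := by
      rw [add_comm]
      exact hXj.mul (hU hq)
    have h1 := act_point h _ _ hpq
    have h2 : φ (X i ^ j * q) = 0 := by
      apply mem_dualW.mp hφ
      rw [homogeneousComponent_eq_self hpq]
      exact Submodule.mul_mem_mul hXj hq
    rw [h2, eq_comm, mul_eq_zero, or_iff_left hne, map_mul, mul_eq_zero, map_pow, eval_X] at h1
    exact h1.resolve_left (pow_ne_zero _ hi)

theorem stmt6 (n d k : ℕ) (hn : 2 ≤ n) (hd : 2 ≤ d) (hkd : k ≤ d)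
    (U : Submodule ℂ (PolyR n)) (hU : U ≤ formSpace n d)
    (hbpf : IsBPF n U) (hcodim : vcodim n d U = k) :
    vcodim n (2 * d - 1) (formSpace n (d - 1) * U) ≤ 1 ∧
    (k < d → formSpace n (d - 1) * U = formSpace n (2 * d - 1)) := by
  have h0 : formSpace n 0 * U = U := by
    have : formSpace n 0 = 1 := homogeneousSubmodule_zero (Fin n)
    rw [this, one_mul]
  have key : ∀ j, vcodim n (d + j) (formSpace n j * U) ≤ k - j := by
    intro j
    induction j with
    | zero => rw [h0, add_zero, hcodim, Nat.sub_zero]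
    | succ j ih =>
      have := step (by omega) U hU hbpf j (by omega)
      omega
  have h1 := key (d - 1)
  have e : d + (d - 1) = 2 * d - 1 := by omega
  rw [e] at h1
  refine ⟨by omega, fun hk => ?_⟩
  have hle : formSpace n (d - 1) * U ≤ formSpace n (2 * d - 1) := by
    rw [← e, add_comm]
    exact (mul_le_mul' le_rfl hU).trans (homogeneousSubmodule_mul (d - 1) d)
  apply Submodule.eq_of_le_of_finrank_le hle
  unfold vcodim at h1
  omega
end
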